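/- arXiv:1808.10849 — 2 statements merged into one kernel-verified Lean document; each statement's English description precedes it below -/
import Mathlib

section
/- Let δ₁ and δ₂ be two irreducible non-planar curves in ℂP^d, d ≥ 3, of degree e₁ and e₂ respectively. Then there are at most O(e₁e₂) points p on δ₁ such that the Zariski closures of π_p(δ₁∖{p}) and π_p(δ₂∖{p}) coincide. -/
open scoped Pointwise
open Classical

noncomputable section

/-- `n`-dimensional projective space over `𝔽`. -/
abbrev PS (𝔽 : Type) [Field 𝔽] (n : ℕ) := Projectivization 𝔽 (Fin (n + 1) → 𝔽)

/-- A projective flat of projective dimension `r - 1` (linear rank `r`), as a set of points. -/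
def IsFlatOfRank {𝔽 : Type} [Field 𝔽] {n : ℕ} (r : ℕ) (S : Set (PS 𝔽 n)) : Prop :=
  ∃ W : Submodule 𝔽 (Fin (n + 1) → 𝔽), Module.finrank 𝔽 W = r ∧ S = {x | x.submodule ≤ W}

/-- A hyperplane of `PS 𝔽 n`, as a set of points. -/
def IsHypSet {𝔽 : Type} [Field 𝔽] {n : ℕ} (S : Set (PS 𝔽 n)) : Prop := IsFlatOfRank n S

/-- The linear span of a set of projective points. -/
def projSpan {𝔽 : Type} [Field 𝔽] {n : ℕ} (S : Set (PS 𝔽 n)) : Submodule 𝔽 (Fin (n + 1) → 𝔽) :=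
  ⨆ x ∈ S, x.submodule

/-- Every `d` points of `P` span a hyperplane (of `PS 𝔽 d`). -/
def SpanEveryd {𝔽 : Type} [Field 𝔽] {n : ℕ} (d : ℕ) (P : Set (PS 𝔽 n)) : Prop :=
  ∀ S : Set (PS 𝔽 n), S ⊆ P → S.Finite → S.ncard = d → Module.finrank 𝔽 (projSpan S) = d

/-- The hyperplanes passing through exactly `k` points of `P`. -/
def hypThrough {𝔽 : Type} [Field 𝔽] {n : ℕ} (P : Set (PS 𝔽 n)) (k : ℕ) :
    Set (Submodule 𝔽 (Fin (n + 1) → 𝔽)) :=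
  {W | Module.finrank 𝔽 W = n ∧ ({x ∈ P | x.submodule ≤ W}).ncard = k}

/-- The number of hyperplanes passing through exactly `k` points of `P`.
`numHyp P n` is the number of ordinary hyperplanes of `P ⊆ PS 𝔽 n`;
`numHyp P (n+1)` is the number of `(n+1)`-point hyperplanes. -/
def numHyp {𝔽 : Type} [Field 𝔽] {n : ℕ} (P : Set (PS 𝔽 n)) (k : ℕ) : ℕ :=
  (hypThrough P k).ncard
/-- The projective zero locus of a set of (homogeneous) polynomials. -/
def projZeroLocus {n : ℕ} (S : Set (MvPolynomial (Fin (n + 1)) ℂ)) : Set (PS ℂ n) :=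
  {x | ∀ f ∈ S, ∀ v ∈ x.submodule, MvPolynomial.eval v f = 0}

/-- A (closed, projective) algebraic set in `ℂPⁿ`. -/
def IsAlg {n : ℕ} (V : Set (PS ℂ n)) : Prop :=
  ∃ S : Set (MvPolynomial (Fin (n + 1)) ℂ),
    (∀ f ∈ S, ∃ e, f.IsHomogeneous e) ∧ V = projZeroLocus S

/-- The Zariski closure of a set of points of `ℂPⁿ`. -/
def zclosure {n : ℕ} (A : Set (PS ℂ n)) : Set (PS ℂ n) :=
  ⋂₀ {V | IsAlg V ∧ A ⊆ V}

/-- An irreducible algebraic set in `ℂPⁿ`. -/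
def IsIrredAlg {n : ℕ} (V : Set (PS ℂ n)) : Prop :=
  IsAlg V ∧ V.Nonempty ∧
    ∀ V₁ V₂ : Set (PS ℂ n), IsAlg V₁ → IsAlg V₂ → V ⊆ V₁ ∪ V₂ → V ⊆ V₁ ∨ V ⊆ V₂

/-- An irreducible component of an algebraic set. -/
def IsComponentOf {n : ℕ} (C V : Set (PS ℂ n)) : Prop :=
  IsIrredAlg C ∧ C ⊆ V ∧ ∀ C' : Set (PS ℂ n), IsIrredAlg C' → C' ⊆ V → C ⊆ C' → C = C'

/-- `V` is non-degenerate: it is not contained in a hyperplane. -/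
def NonDeg {n : ℕ} (V : Set (PS ℂ n)) : Prop := ∀ S : Set (PS ℂ n), IsHypSet S → ¬V ⊆ S

/-- `V` is non-planar: it is not contained in a 2-flat. -/
def NonPlanar {n : ℕ} (V : Set (PS ℂ n)) : Prop := ∀ S : Set (PS ℂ n), IsFlatOfRank 3 S → ¬V ⊆ S

/-- A projective variety of pure dimension 1: it is algebraic, some hyperplane meets it in
finitely many points (dimension at most 1), and every irreducible component is infinite
(dimension at least 1). -/
def IsPureCurve {n : ℕ} (V : Set (PS ℂ n)) : Prop :=
  IsAlg V ∧ (∃ S : Set (PS ℂ n), IsHypSet S ∧ (V ∩ S).Finite) ∧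
    ∀ C, IsComponentOf C V → C.Infinite

/-- A curve of degree `e` in `ℂPⁿ`: a pure 1-dimensional variety such that the maximum number
of points in a finite intersection with a hyperplane is `e`. -/
def IsCurveDeg {n : ℕ} (V : Set (PS ℂ n)) (e : ℕ) : Prop :=
  IsPureCurve V ∧
    IsGreatest {m : ℕ | ∃ S : Set (PS ℂ n), IsHypSet S ∧ (V ∩ S).Finite ∧ (V ∩ S).ncard = m} e

/-- All homogeneous polynomials vanishing on `V`. -/
def vanishingForms {n : ℕ} (V : Set (PS ℂ n)) : Set (MvPolynomial (Fin (n + 1)) ℂ) :=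
  {f | (∃ e, f.IsHomogeneous e) ∧ ∀ x ∈ V, ∀ v ∈ x.submodule, MvPolynomial.eval v f = 0}

/-- The (affine cone of the) Zariski tangent space of `V` at `x`. -/
def tangentSpaceAt {n : ℕ} (V : Set (PS ℂ n)) (x : PS ℂ n) : Submodule ℂ (Fin (n + 1) → ℂ) :=
  ⨅ f ∈ vanishingForms V,
    LinearMap.ker (∑ i : Fin (n + 1),
      MvPolynomial.eval x.rep (MvPolynomial.pderiv i f) •
        (LinearMap.proj i : (Fin (n + 1) → ℂ) →ₗ[ℂ] ℂ))

/-- A smooth point of a curve `V`: the tangent space has (affine) dimension 2. -/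
def IsSmoothPt {n : ℕ} (V : Set (PS ℂ n)) (x : PS ℂ n) : Prop :=
  x ∈ V ∧ Module.finrank ℂ (tangentSpaceAt V x) = 2

/-- The set of smooth points of a curve `V`. -/
def smoothPts {n : ℕ} (V : Set (PS ℂ n)) : Set (PS ℂ n) := {x | IsSmoothPt V x}

/-- A smooth curve. -/
def IsSmoothCurve {n : ℕ} (V : Set (PS ℂ n)) : Prop := ∀ x ∈ V, IsSmoothPt V x

/-- A real point of `ℂPⁿ`: one admitting a representative vector with real coordinates. -/
def IsRealPt {n : ℕ} (x : PS ℂ n) : Prop := ∃ v ∈ x.submodule, v ≠ 0 ∧ ∀ i, (v i).im = 0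

/-- A real curve: each irreducible component contains infinitely many real points. -/
def IsRealCurve {n : ℕ} (V : Set (PS ℂ n)) : Prop :=
  ∀ C, IsComponentOf C V → {x ∈ C | IsRealPt x}.Infinite

/-- The natural embedding `ℝPⁿ → ℂPⁿ`. -/
def cx {n : ℕ} (x : PS ℝ n) : PS ℂ n :=
  Projectivization.mk ℂ (fun i => (x.rep i : ℂ)) (by
    intro hc
    apply x.rep_nonzero
    funext i
    have h := congrFun hc i
    simp only [Pi.zero_apply] at h ⊢
    exact_mod_cast h)
/-- The image of a set `A ⊆ ℂPⁿ⁺¹` under the projection induced by the linear map `f`. -/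
def projImage {n : ℕ} (f : (Fin (n + 2) → ℂ) →ₗ[ℂ] (Fin (n + 1) → ℂ))
    (A : Set (PS ℂ (n + 1))) : Set (PS ℂ n) :=
  {y | ∃ x ∈ A, ∃ h : f x.rep ≠ 0, y = Projectivization.mk ℂ (f x.rep) h}

/-- The projection induced by `f` is generically one-to-one on `A`: it is injective away
from some finite subset of `A`. -/
def GenOneToOneOn {n : ℕ} (f : (Fin (n + 2) → ℂ) →ₗ[ℂ] (Fin (n + 1) → ℂ))
    (A : Set (PS ℂ (n + 1))) : Prop :=
  ∃ S : Set (PS ℂ (n + 1)), S.Finite ∧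
    ∀ x₁ ∈ A \ S, ∀ x₂ ∈ A \ S,
      (∃ c : ℂ, c ≠ 0 ∧ f x₁.rep = c • f x₂.rep) → x₁ = x₂

section auxiliary

open MvPolynomial TensorProduct

/-- The linear form attached to a functional on `ℂᵐ`. -/
def linForm {M : ℕ} (φ : Module.Dual ℂ (Fin M → ℂ)) : MvPolynomial (Fin M) ℂ :=
  ∑ i, C (φ (Pi.single i 1)) * X i

lemma eval_linForm {M : ℕ} (φ : Module.Dual ℂ (Fin M → ℂ)) (v : Fin M → ℂ) :
    eval v (linForm φ) = φ v := by
  conv_rhs => rw [← Finset.univ_sum_single v]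
  simp only [linForm, map_sum, map_mul, eval_C, eval_X]
  refine Finset.sum_congr rfl fun i _ => ?_
  rw [show (Pi.single i (v i) : Fin M → ℂ) = v i • Pi.single i 1 by simp [← Pi.single_smul]]
  simp [mul_comm]

lemma isHomogeneous_linForm {M : ℕ} (φ : Module.Dual ℂ (Fin M → ℂ)) :
    (linForm φ).IsHomogeneous 1 :=
  IsHomogeneous.sum _ _ _ fun _ _ => isHomogeneous_C_mul_X _ _

lemma eval_smul_of_isHomogeneous {M d : ℕ} {f : MvPolynomial (Fin M) ℂ} (hf : f.IsHomogeneous d)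
    (c : ℂ) (v : Fin M → ℂ) : eval (c • v) f = c ^ d * eval v f := by
  rw [eval_eq, eval_eq, Finset.mul_sum]
  refine Finset.sum_congr rfl fun α hα => ?_
  have : ∑ i, α i = d := by
    rw [← hf (mem_support_iff.1 hα), Finsupp.weight_apply, Finsupp.sum_fintype _ _ (by simp)]
    simp
  have h2 : ∏ i ∈ α.support, (c • v) i ^ α i = c ^ d * ∏ i ∈ α.support, v i ^ α i := by
    rw [← this, ← Finset.sum_subset (Finset.subset_univ α.support) (by simp),
      ← Finset.prod_pow_eq_pow_sum, ← Finset.prod_mul_distrib]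
    simp [mul_pow]
  rw [h2]; ring

/-- An irreducible affine cone: a Zariski closed, scaling invariant set with prime ideal. -/
structure IsIrredCone {M : ℕ} (Z : Set (Fin M → ℂ)) : Prop where
  smul_mem : ∀ (c : ℂ) (v : Fin M → ℂ), v ∈ Z → c • v ∈ Z
  isPrime : (vanishingIdeal ℂ Z).IsPrime
  mem_of : ∀ v, (∀ f ∈ vanishingIdeal ℂ Z, eval v f = 0) → v ∈ Z

lemma homogeneousComponent_mem_vanishingIdeal {M : ℕ} {Z : Set (Fin M → ℂ)}
    (hZ : ∀ (c : ℂ) (v : Fin M → ℂ), v ∈ Z → c • v ∈ Z) {f : MvPolynomial (Fin M) ℂ}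
    (hf : f ∈ vanishingIdeal ℂ Z) (d : ℕ) : homogeneousComponent d f ∈ vanishingIdeal ℂ Z := by
  intro v hv
  let P : Polynomial ℂ := ∑ j ∈ Finset.range (f.totalDegree + 1),
    Polynomial.monomial j (eval v (homogeneousComponent j f))
  have hP : P = 0 := by
    refine Polynomial.funext fun c => ?_
    have h := hf _ (hZ c v hv)
    change eval (c • v) f = 0 at h
    rw [← sum_homogeneousComponent f, map_sum] at h
    simp only [P, Polynomial.eval_finsetSum, Polynomial.eval_monomial, Polynomial.eval_zero]
    rw [← h]
    refine Finset.sum_congr rfl fun j _ => ?_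
    rw [eval_smul_of_isHomogeneous (homogeneousComponent_isHomogeneous j f), mul_comm]
  by_cases hd : d < f.totalDegree + 1
  · have := congrArg (fun Q => Polynomial.coeff Q d) hP
    simp only [P, Polynomial.finsetSum_coeff, Polynomial.coeff_monomial, Polynomial.coeff_zero] at this
    rw [Finset.sum_ite_eq' , if_pos (Finset.mem_range.2 hd)] at this
    exact this
  · rw [homogeneousComponent_eq_zero _ _ (by omega)]; simp

section cone
variable {M : ℕ} {Z : Set (Fin M → ℂ)} {s t : Module.Dual ℂ (Fin M → ℂ)}

/-- The coordinate ring of an affine cone. -/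
def ConeRing (Z : Set (Fin M → ℂ)) : Type := MvPolynomial (Fin M) ℂ ⧸ vanishingIdeal ℂ Z

instance (Z : Set (Fin M → ℂ)) : CommRing (ConeRing Z) := Ideal.Quotient.commRing _

/-- The restriction of polynomials to an affine cone. -/
def coneMk (Z : Set (Fin M → ℂ)) : MvPolynomial (Fin M) ℂ →+* ConeRing Z := Ideal.Quotient.mk _

lemma coneMk_surjective (Z : Set (Fin M → ℂ)) : Function.Surjective (coneMk Z) :=
  Ideal.Quotient.mk_surjective

lemma coneMk_eq_zero {Z : Set (Fin M → ℂ)} {f : MvPolynomial (Fin M) ℂ} :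
    coneMk Z f = 0 ↔ ∀ v ∈ Z, eval v f = 0 :=
  Ideal.Quotient.eq_zero_iff_mem

lemma IsIrredCone.isDomain (hZ : IsIrredCone Z) : IsDomain (ConeRing Z) :=
  (Ideal.Quotient.isDomain_iff_prime _).2 hZ.isPrime

/-- The ring homomorphism `ℂ[S, T] → ℂ[X] / I(Z)` sending `S`, `T` to two linear forms. -/
def pencilHom (Z : Set (Fin M → ℂ)) (s t : Module.Dual ℂ (Fin M → ℂ)) :
    MvPolynomial (Fin 2) ℂ →+* ConeRing Z :=
  (coneMk Z).comp (aeval ![linForm s, linForm t]).toRingHom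

lemma eval_aeval_linForm (c : MvPolynomial (Fin 2) ℂ) (v : Fin M → ℂ) :
    eval v (aeval ![linForm s, linForm t] c) = eval ![s v, t v] c := by
  have : (aeval v).comp (aeval ![linForm s, linForm t]) =
      (aeval ![s v, t v] : MvPolynomial (Fin 2) ℂ →ₐ[ℂ] ℂ) := by
    ext i
    fin_cases i <;> simp [eval_linForm, aeval_eq_eval]
  exact DFunLike.congr_fun this c

lemma exists_X_pow_mem (hZ : IsIrredCone Z) (hst : ∀ v ∈ Z, s v = 0 → t v = 0 → v = 0)
    (i : Fin M) : ∃ m : ℕ, (X i : MvPolynomial (Fin M) ℂ) ^ m ∈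
      vanishingIdeal ℂ Z ⊔ Ideal.span {linForm s, linForm t} := by
  have : (X i : MvPolynomial (Fin M) ℂ) ∈
      (vanishingIdeal ℂ Z ⊔ Ideal.span {linForm s, linForm t}).radical := by
    rw [← vanishingIdeal_zeroLocus_eq_radical (K := ℂ)]
    intro v hv
    have hvZ : v ∈ Z := hZ.mem_of v fun f hf => by
      exact hv f (Ideal.mem_sup_left hf)
    have h1 : s v = 0 := by
      rw [← eval_linForm]
      exact hv _ (Ideal.mem_sup_right (Ideal.subset_span (by simp)))
    have h2 : t v = 0 := by
      rw [← eval_linForm]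
      exact hv _ (Ideal.mem_sup_right (Ideal.subset_span (by simp)))
    simp [hst v hvZ h1 h2]
  exact this

lemma exists_uniform_X_pow_mem (hZ : IsIrredCone Z)
    (hst : ∀ v ∈ Z, s v = 0 → t v = 0 → v = 0) : ∃ m : ℕ, ∀ i : Fin M,
      (X i : MvPolynomial (Fin M) ℂ) ^ m ∈
        vanishingIdeal ℂ Z ⊔ Ideal.span {linForm s, linForm t} := by
  choose m hm using exists_X_pow_mem hZ hst
  refine ⟨∑ i, m i, fun i => ?_⟩
  obtain ⟨k, hk⟩ := Nat.exists_eq_add_of_le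
    (Finset.single_le_sum (f := m) (fun _ _ => Nat.zero_le _) (Finset.mem_univ i))
  rw [hk, pow_add]
  exact Ideal.mul_mem_right _ _ (hm i)

lemma homogeneousComponent_succ_mul_linForm (d : ℕ) (f : MvPolynomial (Fin M) ℂ)
    (φ : Module.Dual ℂ (Fin M → ℂ)) :
    homogeneousComponent (d + 1) (f * linForm φ) = homogeneousComponent d f * linForm φ := by
  conv_lhs => rw [← sum_homogeneousComponent f, Finset.sum_mul, map_sum]
  have h : ∀ j, homogeneousComponent (d + 1) (homogeneousComponent j f * linForm φ) =
      if j = d then homogeneousComponent d f * linForm φ else 0 := by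
    intro j
    rw [homogeneousComponent_of_mem
      ((homogeneousComponent_isHomogeneous j f).mul (isHomogeneous_linForm φ))]
    by_cases hj : j = d
    · simp [hj]
    · rw [if_neg (by omega), if_neg hj]
  simp only [h, Finset.sum_ite_eq', Finset.mem_range]
  split_ifs with hd
  · rfl
  · rw [homogeneousComponent_eq_zero _ _ (by omega), zero_mul]

lemma pencilHom_finite (hZ : IsIrredCone Z) (hst : ∀ v ∈ Z, s v = 0 → t v = 0 → v = 0) :
    (pencilHom Z s t).Finite := by
  obtain ⟨m, hm⟩ := exists_uniform_X_pow_mem hZ hst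
  let _ := (pencilHom Z s t).toAlgebra
  let B : Set (Fin M →₀ ℕ) := Set.Iic (Finsupp.equivFunOnFinite.symm fun _ => m)
  have hB : B.Finite := Set.finite_Iic _
  let g : (Fin M →₀ ℕ) → ConeRing Z :=
    fun α => coneMk Z (monomial α 1)
  let N := Submodule.span (MvPolynomial (Fin 2) ℂ) (g '' B)
  have hsmul : ∀ (c : MvPolynomial (Fin 2) ℂ) (f : MvPolynomial (Fin M) ℂ),
      coneMk Z f ∈ N →
      coneMk Z (aeval ![linForm s, linForm t] c * f) ∈ N := by
    intro c f hf
    have := N.smul_mem c hf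
    rwa [Algebra.smul_def] at this
  have key : ∀ d : ℕ, ∀ f : MvPolynomial (Fin M) ℂ, f.IsHomogeneous d →
      coneMk Z f ∈ N := by
    intro d
    induction d using Nat.strong_induction_on with
    | _ d ih =>
    intro f hf
    rw [f.as_sum, map_sum]
    refine N.sum_mem fun α hα => ?_
    have hαd : (monomial α (1 : ℂ)).IsHomogeneous d := by
      refine isHomogeneous_monomial _ ?_
      rw [Finsupp.degree_eq_weight_one]
      exact hf (mem_support_iff.1 hα)
    have h1 : g α ∈ N := by
      by_cases hαB : α ∈ B
      · exact Submodule.subset_span ⟨α, hαB, rfl⟩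
      · obtain ⟨i, hi⟩ : ∃ i, m < α i := by
          by_contra! h
          exact hαB fun i => by simpa using h i
        obtain ⟨β, hβ⟩ : ∃ β, α = Finsupp.single i m + β :=
          ⟨α - Finsupp.single i m, by
            rw [add_tsub_cancel_of_le]
            simpa using hi.le⟩
        have hmem : (monomial α (1 : ℂ)) ∈
            vanishingIdeal ℂ Z ⊔ Ideal.span {linForm s, linForm t} := by
          rw [hβ, show (monomial (Finsupp.single i m + β) (1 : ℂ)) = X i ^ m * monomial β 1 by
            rw [X_pow_eq_monomial, monomial_mul, mul_one]]
          exact Ideal.mul_mem_right _ _ (hm i)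
        obtain ⟨u, hu, w, hw, huw⟩ := Submodule.mem_sup.1 hmem
        obtain ⟨a, b, hab⟩ := Ideal.mem_span_pair.1 hw
        have hd : d ≠ 0 := by
          rintro rfl
          have : α.degree = 0 := by
            rw [Finsupp.degree_eq_weight_one]
            exact hf (mem_support_iff.1 hα)
          rw [Finsupp.degree_eq_zero_iff] at this
          simp [this] at hi
        obtain ⟨d, rfl⟩ := Nat.exists_eq_succ_of_ne_zero hd
        have e1 := congrArg (homogeneousComponent (d + 1)) huw
        rw [homogeneousComponent_eq_self hαd, map_add, ← hab, map_add,
          homogeneousComponent_succ_mul_linForm, homogeneousComponent_succ_mul_linForm] at e1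
        have hu' : coneMk Z (homogeneousComponent (d + 1) u) = 0 :=
          coneMk_eq_zero.2
            (homogeneousComponent_mem_vanishingIdeal hZ.smul_mem hu _)
        simp only [g]
        rw [← e1, map_add, hu', zero_add, map_add]
        refine N.add_mem ?_ ?_
        · have := hsmul (X 0) _ (ih d (Nat.lt_succ_self d) _ (homogeneousComponent_isHomogeneous d a))
          simpa [mul_comm] using this
        · have := hsmul (X 1) _ (ih d (Nat.lt_succ_self d) _ (homogeneousComponent_isHomogeneous d b))
          simpa [mul_comm] using this
    have := hsmul (C (coeff α f)) _ h1
    simpa [C_mul_monomial, algebraMap_eq] using this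
  refine ⟨⟨hB.toFinset.image g, ?_⟩⟩
  rw [Finset.coe_image, hB.coe_toFinset, eq_top_iff]
  intro x _
  obtain ⟨f, rfl⟩ := coneMk_surjective Z x
  rw [← sum_homogeneousComponent f, map_sum]
  exact N.sum_mem fun j _ => key j _ (homogeneousComponent_isHomogeneous j f)

end cone

lemma Polynomial.Monic.exists_mul_add_derivative_mul_eq_C {A : Type*} [CommRing A] [IsDomain A]
    [IsIntegrallyClosed A] [CharZero A] {P : Polynomial A} (hP : P.Monic) (hirr : Irreducible P) :
    ∃ d : A, d ≠ 0 ∧ ∃ p q : Polynomial A,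
      P * p + Polynomial.derivative P * q = Polynomial.C d := by
  let K := FractionRing A
  have hinj : Function.Injective (algebraMap A K) := IsFractionRing.injective A K
  have : CharZero K := charZero_of_injective_algebraMap hinj
  have hsep : (P.map (algebraMap A K)).Separable :=
    ((hP.irreducible_iff_irreducible_map_fraction_map (K := K)).1 hirr).separable
  have hP0 : P.natDegree ≠ 0 := by
    intro h
    rw [Polynomial.eq_one_of_monic_natDegree_zero hP h] at hirr
    exact hirr.not_isUnit isUnit_one
  refine ⟨P.resultant (Polynomial.derivative P), ?_, ?_⟩
  · intro h
    have h2 := Polynomial.resultant_map_map P (Polynomial.derivative P) P.natDegree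
      (Polynomial.derivative P).natDegree (algebraMap A K)
    rw [h, map_zero] at h2
    have h3 := Polynomial.resultant_ne_zero _ _ hsep
    rw [Polynomial.derivative_map, Polynomial.natDegree_map_eq_of_injective hinj,
      Polynomial.natDegree_map_eq_of_injective hinj] at h3
    exact h3 h2
  · obtain ⟨p, q, -, -, h⟩ := Polynomial.exists_mul_add_mul_eq_C_resultant P
      (Polynomial.derivative P) le_rfl le_rfl (Or.inl hP0)
    exact ⟨p, q, h⟩

lemma natDegree_aeval_one_X_le {m : ℕ} {b : MvPolynomial (Fin 2) ℂ} (hb : b.IsHomogeneous m) :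
    (aeval ![1, (Polynomial.X : Polynomial ℂ)] b).natDegree ≤ m := by
  rw [aeval_def, eval₂_eq']
  refine Polynomial.natDegree_sum_le_of_forall_le _ _ fun α hα => ?_
  have h := hb (mem_support_iff.1 hα)
  rw [Finsupp.weight_apply, Finsupp.sum_fintype _ _ (by simp)] at h
  simp only [Fin.sum_univ_two, Fin.prod_univ_two] at h ⊢
  simp only [Pi.one_apply, smul_eq_mul, mul_one] at h
  simp only [Matrix.cons_val_zero, Matrix.cons_val_one, one_pow, one_mul]
  refine (Polynomial.natDegree_C_mul_X_pow_le _ _).trans (by omega)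

lemma eval_aeval_one_X (b : MvPolynomial (Fin 2) ℂ) (τ : ℂ) :
    (aeval ![1, (Polynomial.X : Polynomial ℂ)] b).eval τ = eval ![1, τ] b := by
  have : (Polynomial.aeval τ).comp (aeval ![1, (Polynomial.X : Polynomial ℂ)]) =
      (aeval ![1, τ] : MvPolynomial (Fin 2) ℂ →ₐ[ℂ] ℂ) := by
    ext i
    fin_cases i <;> simp
  exact DFunLike.congr_fun this b

lemma aeval_one_X_ne_zero {m : ℕ} {b : MvPolynomial (Fin 2) ℂ} (hb : b.IsHomogeneous m)
    (h0 : b ≠ 0) : aeval ![1, (Polynomial.X : Polynomial ℂ)] b ≠ 0 := by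
  intro h
  have : (X 0 : MvPolynomial (Fin 2) ℂ) * b = 0 := by
    refine MvPolynomial.funext fun v => ?_
    rw [map_mul, eval_X, map_zero]
    by_cases hv : v 0 = 0
    · rw [hv, zero_mul]
    · have h1 : v = v 0 • ![1, v 1 / v 0] := by
        ext i
        fin_cases i
        · simp
        · simp [mul_div_cancel₀ _ hv]
      rw [h1, eval_smul_of_isHomogeneous hb, ← eval_aeval_one_X, h]
      simp
  rcases mul_eq_zero.1 this with h | h
  · exact X_ne_zero _ h
  · exact h0 h

lemma mul_pow_add_sum_mul_pow {R : Type*} [CommRing R] (x : R) (a : ℕ → R) (j : ℕ) :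
    x * (x ^ j + ∑ i ∈ Finset.range j, a i * x ^ i) =
      x ^ (j + 1) + ∑ i ∈ Finset.range j, a i * x ^ (i + 1) := by
  rw [mul_add, Finset.mul_sum, pow_succ']
  congr 1
  refine Finset.sum_congr rfl fun i _ => ?_
  ring

section cone
variable {M : ℕ} {Z : Set (Fin M → ℂ)} {s t : Module.Dual ℂ (Fin M → ℂ)}

/-- Evaluation of elements of the coordinate ring at a point of the cone. -/
def coneEval {v : Fin M → ℂ} (hv : v ∈ Z) : ConeRing Z →+* ℂ :=
  Ideal.Quotient.lift _ (eval v) fun _ hf => hf v hv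

lemma coneEval_coneMk {v : Fin M → ℂ} (hv : v ∈ Z) (f : MvPolynomial (Fin M) ℂ) :
    coneEval hv (coneMk Z f) = eval v f :=
  Ideal.Quotient.lift_mk _ _ _

lemma coneEval_pencilHom {v : Fin M → ℂ} (hv : v ∈ Z) (c : MvPolynomial (Fin 2) ℂ) :
    coneEval hv (pencilHom Z s t c) = eval ![s v, t v] c := by
  rw [← eval_aeval_linForm]
  exact coneEval_coneMk hv _

lemma pencil_fiber_finite (hZ : IsIrredCone Z) (hst : ∀ v ∈ Z, s v = 0 → t v = 0 → v = 0)
    (a b : ℂ) : {v | v ∈ Z ∧ s v = a ∧ t v = b}.Finite := by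
  have hintegral : ∀ i, ∃ P : Polynomial ℂ, P ≠ 0 ∧ ∀ v ∈ Z, s v = a → t v = b → P.eval (v i) = 0 := by
    intro i
    obtain ⟨P, hP, hPe⟩ := (pencilHom_finite hZ hst).to_isIntegral (coneMk Z (X i))
    refine ⟨P.map (eval ![a, b]), (hP.map _).ne_zero, ?_⟩
    rintro v hv rfl rfl
    have := congrArg (coneEval hv) hPe
    rw [Polynomial.hom_eval₂, coneEval_coneMk, eval_X, map_zero] at this
    rw [Polynomial.eval_map, ← this]
    congr 1
    ext c
    · simp [coneEval_pencilHom]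
    · simp [coneEval_pencilHom]
  choose P hP0 hP using hintegral
  refine (Set.Finite.pi' (fun i => (P i).roots.toFinset.finite_toSet)).subset ?_
  rintro v ⟨hv, h1, h2⟩ i
  simpa [hP0 i] using hP i v hv h1 h2

lemma pencilHom_injective (hZ : IsIrredCone Z) (hst : ∀ v ∈ Z, s v = 0 → t v = 0 → v = 0)
    (hinf : {v | v ∈ Z ∧ s v = 1}.Infinite) : Function.Injective (pencilHom Z s t) := by
  have hT : {τ | ∃ v ∈ Z, s v = 1 ∧ t v = τ}.Infinite := by
    intro hfin
    refine hinf ((hfin.biUnion fun τ _ => pencil_fiber_finite hZ hst 1 τ).subset ?_)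
    rintro v ⟨hv, h1⟩
    exact Set.mem_biUnion (x := t v) ⟨v, hv, h1, rfl⟩ ⟨hv, h1, rfl⟩
  rw [injective_iff_map_eq_zero]
  intro c hc
  have hcv : c ∈ vanishingIdeal ℂ ((fun v => ![s v, t v]) '' Z) := by
    rintro _ ⟨v, hv, rfl⟩
    change eval ![s v, t v] c = 0
    rw [← coneEval_pencilHom hv, hc, map_zero]
  have hcomp : ∀ d, homogeneousComponent d c = 0 := by
    intro d
    by_contra h
    have hd := homogeneousComponent_isHomogeneous d c
    refine hT (((aeval ![1, (Polynomial.X : Polynomial ℂ)]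
      (homogeneousComponent d c)).roots.toFinset.finite_toSet).subset ?_)
    rintro τ ⟨v, hv, h1, rfl⟩
    have h3 := homogeneousComponent_mem_vanishingIdeal (Z := (fun v => ![s v, t v]) '' Z) (by
      rintro a _ ⟨v, hv, rfl⟩
      exact ⟨a • v, hZ.smul_mem a v hv, by simp⟩) hcv d _ ⟨v, hv, rfl⟩
    simp only [h1] at h3
    simpa [aeval_one_X_ne_zero hd h, eval_aeval_one_X] using h3
  rw [← sum_homogeneousComponent c]
  exact Finset.sum_eq_zero fun d _ => hcomp d

lemma homogeneousComponent_mul_of_isHomogeneous {m : ℕ} {g : MvPolynomial (Fin M) ℂ}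
    (hg : g.IsHomogeneous m) (d : ℕ) (f : MvPolynomial (Fin M) ℂ) :
    homogeneousComponent (d + m) (f * g) = homogeneousComponent d f * g := by
  conv_lhs => rw [← sum_homogeneousComponent f, Finset.sum_mul, map_sum]
  have h : ∀ j, homogeneousComponent (d + m) (homogeneousComponent j f * g) =
      if j = d then homogeneousComponent d f * g else 0 := by
    intro j
    rw [homogeneousComponent_of_mem ((homogeneousComponent_isHomogeneous j f).mul hg)]
    by_cases hj : j = d
    · simp [hj]
    · rw [if_neg (by omega), if_neg hj]
  simp only [h, Finset.sum_ite_eq', Finset.mem_range]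
  split_ifs with hd
  · rfl
  · rw [homogeneousComponent_eq_zero _ _ (by omega), zero_mul]

lemma homogeneousComponent_aeval_linForm (d : ℕ) (c : MvPolynomial (Fin 2) ℂ) :
    homogeneousComponent d (aeval ![linForm s, linForm t] c) =
      aeval ![linForm s, linForm t] (homogeneousComponent d c) := by
  have hl : ∀ i, (![linForm s, linForm t] i).IsHomogeneous 1 := by
    intro i
    fin_cases i <;> exact isHomogeneous_linForm _
  conv_lhs => rw [← sum_homogeneousComponent c, map_sum, map_sum]
  have h : ∀ j, homogeneousComponent d (aeval ![linForm s, linForm t] (homogeneousComponent j c)) =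
      if j = d then aeval ![linForm s, linForm t] (homogeneousComponent d c) else 0 := by
    intro j
    rw [homogeneousComponent_of_mem ((homogeneousComponent_isHomogeneous j c).aeval _ hl)]
    by_cases hj : j = d
    · simp [hj]
    · rw [if_neg (by omega), if_neg hj]
  simp only [h, Finset.sum_ite_eq', Finset.mem_range]
  split_ifs with hd
  · rfl
  · rw [homogeneousComponent_eq_zero _ _ (by omega), map_zero]

/-- Every root of a specialisation of the minimal polynomial of a form `G` is attained by `G`
on the corresponding fibre. -/
lemma exists_mem_of_isRoot_minpoly (hZ : IsIrredCone Z)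
    (hst : ∀ v ∈ Z, s v = 0 → t v = 0 → v = 0)
    (G : MvPolynomial (Fin M) ℂ) (P : Polynomial (MvPolynomial (Fin 2) ℂ))
    (hker : ∀ Q : Polynomial (MvPolynomial (Fin 2) ℂ),
      Q.eval₂ (pencilHom Z s t) (coneMk Z G) = 0 ↔ P ∣ Q) (a b τ : ℂ)
    (hτ : (P.map (eval ![a, b])).eval τ = 0) :
    ∃ v ∈ Z, s v = a ∧ t v = b ∧ eval v G = τ := by
  by_contra! hno
  let J : Ideal (MvPolynomial (Fin M) ℂ) :=
    vanishingIdeal ℂ Z ⊔ Ideal.span {linForm s - C a, linForm t - C b, G - C τ}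
  have hJ : (1 : MvPolynomial (Fin M) ℂ) ∈ J := by
    have : (1 : MvPolynomial (Fin M) ℂ) ∈ J.radical := by
      rw [← vanishingIdeal_zeroLocus_eq_radical (K := ℂ)]
      intro v hv
      exfalso
      have hvZ : v ∈ Z := hZ.mem_of v fun f hf => hv f (Ideal.mem_sup_left hf)
      have h : ∀ f ∈ ({linForm s - C a, linForm t - C b, G - C τ} :
          Set (MvPolynomial (Fin M) ℂ)), eval v f = 0 := fun f hf =>
        hv f (Ideal.mem_sup_right (Ideal.subset_span hf))
      refine hno v hvZ ?_ ?_ ?_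
      · have := h (linForm s - C a) (by simp)
        rwa [map_sub, eval_linForm, eval_C, sub_eq_zero] at this
      · have := h (linForm t - C b) (by simp)
        rwa [map_sub, eval_linForm, eval_C, sub_eq_zero] at this
      · have := h (G - C τ) (by simp)
        rwa [map_sub, eval_C, sub_eq_zero] at this
    obtain ⟨k, hk⟩ := this
    rwa [one_pow] at hk
  have hPx : P.eval₂ (pencilHom Z s t) (coneMk Z G) = 0 := (hker P).2 dvd_rfl
  let f : AdjoinRoot P →+* ConeRing Z := AdjoinRoot.lift (pencilHom Z s t) (coneMk Z G) hPx
  have hfinj : Function.Injective f := by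
    rw [injective_iff_map_eq_zero]
    intro y hy
    obtain ⟨Q, rfl⟩ := AdjoinRoot.mk_surjective y
    rw [AdjoinRoot.lift_mk, hker] at hy
    exact AdjoinRoot.mk_eq_zero.2 hy
  have hfint : f.IsIntegral := by
    refine RingHom.IsIntegral.tower_top (AdjoinRoot.of P) f ?_
    have : f.comp (AdjoinRoot.of P) = pencilHom Z s t := by
      refine RingHom.ext fun c => ?_
      simp [f]
    rw [this]
    exact (pencilHom_finite hZ hst).to_isIntegral
  let g : AdjoinRoot P →+* ℂ := AdjoinRoot.lift (eval ![a, b]) τ (by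
    rw [← Polynomial.eval_map]; exact hτ)
  have hg : RingHom.ker g ≠ ⊤ := RingHom.ker_ne_top g
  refine hg ((Ideal.map_eq_top_iff f hfinj hfint).1 ?_)
  rw [Ideal.eq_top_iff_one]
  have hle : J ≤ ((RingHom.ker g).map f).comap (coneMk Z) := by
    refine sup_le ?_ ?_
    · intro h hh
      rw [Ideal.mem_comap, coneMk_eq_zero.2 hh]
      exact Ideal.zero_mem _
    · rw [Ideal.span_le]
      rintro h (rfl | rfl | rfl)
      · have : (AdjoinRoot.of P (X 0 - C a)) ∈ RingHom.ker g := by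
          simp [RingHom.mem_ker, g]
        have h2 := Ideal.mem_map_of_mem f this
        have h3 : f (AdjoinRoot.of P (X 0 - C a)) = coneMk Z (linForm s - C a) := by
          simp only [f, AdjoinRoot.lift_of]
          simp [pencilHom, algebraMap_eq]
        rw [h3] at h2
        exact h2
      · have : (AdjoinRoot.of P (X 1 - C b)) ∈ RingHom.ker g := by
          simp [RingHom.mem_ker, g]
        have h2 := Ideal.mem_map_of_mem f this
        have h3 : f (AdjoinRoot.of P (X 1 - C b)) = coneMk Z (linForm t - C b) := by
          simp only [f, AdjoinRoot.lift_of]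
          simp [pencilHom, algebraMap_eq]
        rw [h3] at h2
        exact h2
      · have : (AdjoinRoot.root P - AdjoinRoot.of P (C τ)) ∈ RingHom.ker g := by
          simp [RingHom.mem_ker, g]
        have h2 := Ideal.mem_map_of_mem f this
        have h3 : f (AdjoinRoot.root P - AdjoinRoot.of P (C τ)) = coneMk Z (G - C τ) := by
          simp only [f, map_sub, AdjoinRoot.lift_of, AdjoinRoot.lift_root]
          simp [pencilHom, algebraMap_eq]
        rw [h3] at h2
        exact h2
  have := hle hJ
  rwa [Ideal.mem_comap, map_one] at this

/-- A form `G` of degree `m` on a cone of degree at most `e` satisfies a monic homogeneous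
equation of degree at most `e` over the binary forms in two general linear forms. -/
lemma exists_homogeneous_equation (hZ : IsIrredCone Z)
    (hst : ∀ v ∈ Z, s v = 0 → t v = 0 → v = 0)
    (hinf : {v | v ∈ Z ∧ s v = 1}.Infinite) {e : ℕ}
    (hdeg : ∀ a b : ℂ, (a ≠ 0 ∨ b ≠ 0) → ∀ F : Finset (Fin M → ℂ),
      (∀ v ∈ F, v ∈ Z ∧ s v = a ∧ t v = b) → F.card ≤ e)
    {m : ℕ} {G : MvPolynomial (Fin M) ℂ} (hG : G.IsHomogeneous m) :
    ∃ k : ℕ, 0 < k ∧ k ≤ e ∧ ∃ c : ℕ → MvPolynomial (Fin 2) ℂ,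
      (∀ i < k, (c i).IsHomogeneous (m * (k - i))) ∧
      (∀ v ∈ Z, eval v G ^ k + ∑ i ∈ Finset.range k, eval ![s v, t v] (c i) * eval v G ^ i = 0) ∧
      ((∃ v ∈ Z, eval v G ≠ 0) → c 0 ≠ 0) := by
  have := hZ.isDomain
  let _ := (pencilHom Z s t).toAlgebra
  have hinj : Function.Injective (algebraMap (MvPolynomial (Fin 2) ℂ) (ConeRing Z)) :=
    pencilHom_injective hZ hst hinf
  have : Module.IsTorsionFree (MvPolynomial (Fin 2) ℂ) (ConeRing Z) :=
    Module.isTorsionFree_iff_algebraMap_injective.2 hinj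
  have hintegral : IsIntegral (MvPolynomial (Fin 2) ℂ) (coneMk Z G) :=
    (pencilHom_finite hZ hst).to_isIntegral _
  let P := minpoly (MvPolynomial (Fin 2) ℂ) (coneMk Z G)
  have hPm : P.Monic := minpoly.monic hintegral
  have hPi : Irreducible P := minpoly.irreducible hintegral
  have hP0 : 0 < P.natDegree := minpoly.natDegree_pos hintegral
  have hPx : P.eval₂ (pencilHom Z s t) (coneMk Z G) = 0 := minpoly.aeval _ (coneMk Z G)
  refine ⟨P.natDegree, hP0, ?_, fun i => homogeneousComponent (m * (P.natDegree - i)) (P.coeff i),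
    fun i _ => homogeneousComponent_isHomogeneous _ _, ?_⟩
  · obtain ⟨d, hd0, p, q, hpq⟩ := hPm.exists_mul_add_derivative_mul_eq_C hPi
    obtain ⟨w, hw⟩ : ∃ w : Fin 2 → ℂ, eval w (X 0 * d) ≠ 0 := by
      by_contra! h
      exact mul_ne_zero (X_ne_zero 0) hd0 (MvPolynomial.funext fun w => by rw [h w, map_zero])
    rw [map_mul, eval_X, mul_ne_zero_iff] at hw
    have hww : w = ![w 0, w 1] := by ext i; fin_cases i <;> rfl
    have hsep : (P.map (eval w)).Separable := by
      have h := congrArg (Polynomial.map (eval w)) hpq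
      simp only [Polynomial.map_add, Polynomial.map_mul, Polynomial.map_C,
        ← Polynomial.derivative_map] at h
      refine ⟨Polynomial.C (eval w d)⁻¹ * p.map (eval w), Polynomial.C (eval w d)⁻¹ * q.map (eval w),
        ?_⟩
      calc _ = Polynomial.C (eval w d)⁻¹ * (P.map (eval w) * p.map (eval w) +
            Polynomial.derivative (P.map (eval w)) * q.map (eval w)) := by ring
        _ = 1 := by rw [h, ← Polynomial.C_mul, inv_mul_cancel₀ hw.2, Polynomial.C_1]
    have hcard : (P.map (eval w)).roots.toFinset.card = P.natDegree := by
      rw [Multiset.toFinset_card_of_nodup (Polynomial.nodup_roots hsep),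
        ← (IsAlgClosed.splits _).natDegree_eq_card_roots, hPm.natDegree_map]
    have hex : ∀ τ : ℂ, ∃ v, τ ∈ (P.map (eval w)).roots.toFinset →
        v ∈ Z ∧ s v = w 0 ∧ t v = w 1 ∧ eval v G = τ := by
      intro τ
      by_cases hτ : τ ∈ (P.map (eval w)).roots.toFinset
      · have hτ' : (P.map (eval ![w 0, w 1])).eval τ = 0 := by
          rw [← hww]
          simpa [(hPm.map _).ne_zero] using hτ
        obtain ⟨v, h⟩ := exists_mem_of_isRoot_minpoly hZ hst G P
          (fun Q => minpoly.isIntegrallyClosed_dvd_iff hintegral Q) (w 0) (w 1) τ hτ'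
        exact ⟨v, fun _ => h⟩
      · exact ⟨0, fun h => absurd h hτ⟩
    choose r hr using hex
    rw [← hcard, ← Finset.card_image_of_injOn (f := r)]
    · refine hdeg (w 0) (w 1) (Or.inl hw.1) _ fun v hv => ?_
      obtain ⟨τ, hτ, rfl⟩ := Finset.mem_image.1 hv
      exact ⟨(hr τ hτ).1, (hr τ hτ).2.1, (hr τ hτ).2.2.1⟩
    · intro τ hτ τ' hτ' h
      rw [← (hr τ hτ).2.2.2, ← (hr τ' hτ').2.2.2, h]
  have hrel : G ^ P.natDegree + ∑ i ∈ Finset.range P.natDegree,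
      aeval ![linForm s, linForm t] (homogeneousComponent (m * (P.natDegree - i)) (P.coeff i)) *
        G ^ i ∈ vanishingIdeal ℂ Z := by
    have h1 : ∑ i ∈ Finset.range (P.natDegree + 1),
        aeval ![linForm s, linForm t] (P.coeff i) * G ^ i ∈ vanishingIdeal ℂ Z := by
      rw [← Ideal.Quotient.eq_zero_iff_mem]
      change coneMk Z _ = 0
      rw [← hPx, Polynomial.eval₂_eq_sum_range, map_sum]
      refine Finset.sum_congr rfl fun i _ => ?_
      rw [map_mul, map_pow]
      rfl
    have h2 := homogeneousComponent_mem_vanishingIdeal hZ.smul_mem h1 (m * P.natDegree)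
    convert h2 using 1
    rw [map_sum, Finset.sum_range_succ, add_comm]
    have h3 : ∀ i ≤ P.natDegree, homogeneousComponent (m * P.natDegree)
        (aeval ![linForm s, linForm t] (P.coeff i) * G ^ i) = aeval ![linForm s, linForm t]
          (homogeneousComponent (m * (P.natDegree - i)) (P.coeff i)) * G ^ i := by
      intro i hi
      rw [← homogeneousComponent_aeval_linForm,
        ← homogeneousComponent_mul_of_isHomogeneous (hG.pow i), ← mul_add, Nat.sub_add_cancel hi]
    congr 1
    · exact Finset.sum_congr rfl fun i hi => (h3 i (Finset.mem_range.1 hi).le).symm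
    · rw [h3 _ le_rfl, hPm.coeff_natDegree, Nat.sub_self, mul_zero, homogeneousComponent_eq_self
        (isHomogeneous_one _ _), map_one, one_mul]
  refine ⟨fun v hv => ?_, ?_⟩
  · have := hrel v hv
    change eval v _ = 0 at this
    simpa only [map_add, map_sum, map_mul, map_pow, eval_aeval_linForm] using this
  · rintro ⟨v, hv, hGv⟩ hc
    have hx : coneMk Z G ≠ 0 := fun h => hGv (coneMk_eq_zero.1 h v hv)
    obtain ⟨j, hj⟩ := Nat.exists_eq_succ_of_ne_zero hP0.ne'
    rw [hj] at hrel hc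
    beta_reduce at hc
    rw [Finset.sum_range_succ', hc, map_zero, zero_mul, add_zero] at hrel
    let Q : Polynomial (MvPolynomial (Fin 2) ℂ) := Polynomial.X ^ j + ∑ i ∈ Finset.range j,
      Polynomial.C (homogeneousComponent (m * (j + 1 - (i + 1))) (P.coeff (i + 1))) *
        Polynomial.X ^ i
    have hdegQ : (∑ i ∈ Finset.range j,
        Polynomial.C (homogeneousComponent (m * (j + 1 - (i + 1))) (P.coeff (i + 1))) *
          Polynomial.X ^ i).degree < (j : WithBot ℕ) := by
      refine (Polynomial.degree_sum_le _ _).trans_lt ?_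
      refine (Finset.sup_lt_iff (WithBot.bot_lt_coe j)).2 fun i hi => ?_
      refine (Polynomial.degree_C_mul_X_pow_le _ _).trans_lt ?_
      exact WithBot.coe_lt_coe.2 (Finset.mem_range.1 hi)
    have hQm : Q.Monic := Polynomial.monic_X_pow_add hdegQ
    have hQdeg : Q.degree = j := by
      rw [Polynomial.degree_add_eq_left_of_degree_lt (by rwa [Polynomial.degree_X_pow]),
        Polynomial.degree_X_pow]
    have hQx : Polynomial.aeval (coneMk Z G) Q = 0 := by
      have h4 : coneMk Z G * Polynomial.aeval (coneMk Z G) Q = 0 := by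
        have h5 := (Ideal.Quotient.eq_zero_iff_mem (I := vanishingIdeal ℂ Z)).2 hrel
        change coneMk Z _ = 0 at h5
        rw [← h5]
        simp only [Q, map_add, map_sum, map_mul, map_pow, Polynomial.aeval_X, Polynomial.aeval_C]
        exact mul_pow_add_sum_mul_pow _ _ j
      exact (mul_eq_zero.1 h4).resolve_left hx
    have h6 := minpoly.min (A := MvPolynomial (Fin 2) ℂ) (x := coneMk Z G) hQm hQx
    rw [Polynomial.degree_eq_natDegree hPm.ne_zero, hj, hQdeg] at h6
    exact absurd (by exact_mod_cast h6) (Nat.not_succ_le_self j)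

end cone

section curve
variable {n : ℕ}

lemma mem_submodule_iff {x : PS ℂ n} {v : Fin (n + 1) → ℂ} :
    v ∈ x.submodule ↔ ∃ c : ℂ, c • x.rep = v := by
  rw [Projectivization.submodule_eq, Submodule.mem_span_singleton]

lemma rep_mem_submodule (x : PS ℂ n) : x.rep ∈ x.submodule :=
  mem_submodule_iff.2 ⟨1, one_smul _ _⟩

lemma eq_mk_of_mem_submodule {x : PS ℂ n} {v : Fin (n + 1) → ℂ} (hv : v ≠ 0)
    (hx : v ∈ x.submodule) : x = Projectivization.mk ℂ v hv := by
  obtain ⟨c, hc⟩ := mem_submodule_iff.1 hx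
  rw [← x.mk_rep, Projectivization.mk_eq_mk_iff']
  have hc0 : c ≠ 0 := by
    rintro rfl
    exact hv (by rw [← hc, zero_smul])
  exact ⟨c⁻¹, by rw [← hc, smul_smul, inv_mul_cancel₀ hc0, one_smul]⟩

lemma eq_of_mem_submodule {x y : PS ℂ n} {v : Fin (n + 1) → ℂ} (hv : v ≠ 0)
    (hx : v ∈ x.submodule) (hy : v ∈ y.submodule) : x = y :=
  (eq_mk_of_mem_submodule hv hx).trans (eq_mk_of_mem_submodule hv hy).symm

/-- The affine cone over a set of projective points. -/
def projCone (δ : Set (PS ℂ n)) : Set (Fin (n + 1) → ℂ) := {v | ∃ x ∈ δ, v ∈ x.submodule}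

lemma rep_mem_projCone {δ : Set (PS ℂ n)} {x : PS ℂ n} (hx : x ∈ δ) : x.rep ∈ projCone δ :=
  ⟨x, hx, rep_mem_submodule x⟩

lemma mem_of_mem_projCone {δ : Set (PS ℂ n)} {x : PS ℂ n} {v : Fin (n + 1) → ℂ} (hv : v ≠ 0)
    (hx : v ∈ x.submodule) (h : v ∈ projCone δ) : x ∈ δ := by
  obtain ⟨y, hy, hvy⟩ := h
  rwa [eq_of_mem_submodule hv hx hvy]

lemma smul_mem_projCone {δ : Set (PS ℂ n)} (c : ℂ) {v : Fin (n + 1) → ℂ} (h : v ∈ projCone δ) :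
    c • v ∈ projCone δ := by
  obtain ⟨x, hx, hv⟩ := h
  exact ⟨x, hx, x.submodule.smul_mem c hv⟩

lemma eval_eq_zero_of_mem_submodule {m : ℕ} {G : MvPolynomial (Fin (n + 1)) ℂ}
    (hG : G.IsHomogeneous m) {x : PS ℂ n} {v w : Fin (n + 1) → ℂ} (hv0 : v ≠ 0)
    (hv : v ∈ x.submodule) (h : eval v G = 0) (hw : w ∈ x.submodule) : eval w G = 0 := by
  rw [eq_mk_of_mem_submodule hv0 hv, Projectivization.submodule_mk,
    Submodule.mem_span_singleton] at hw
  obtain ⟨c, rfl⟩ := hw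
  rw [eval_smul_of_isHomogeneous hG, h, mul_zero]

lemma IsIrredAlg.isIrredCone {δ : Set (PS ℂ n)} (hδ : IsIrredAlg δ) :
    IsIrredCone (projCone δ) := by
  obtain ⟨⟨S, hS, hδS⟩, ⟨x₀, hx₀⟩, hirr⟩ := hδ
  refine ⟨fun c v hv => smul_mem_projCone c hv, ?_, ?_⟩
  · let _ : GradedAlgebra (homogeneousSubmodule (Fin (n + 1)) ℂ) := MvPolynomial.gradedAlgebra
    have hhom : (vanishingIdeal ℂ (projCone δ)).IsHomogeneous
        (homogeneousSubmodule (Fin (n + 1)) ℂ) := by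
      intro i f hf
      have := homogeneousComponent_mem_vanishingIdeal
        (fun c v hv => smul_mem_projCone (δ := δ) c hv) hf i
      rwa [← decomposition.decompose'_apply] at this
    refine hhom.isPrime_of_homogeneous_mem_or_mem ?_ ?_
    · rw [Ideal.ne_top_iff_one]
      intro h
      have := h _ (rep_mem_projCone hx₀)
      simp at this
    · rintro f g ⟨d, hf⟩ ⟨d', hg⟩ hfg
      have hsub : δ ⊆ projZeroLocus {f} ∪ projZeroLocus {g} := by
        intro x hx
        have := hfg _ (rep_mem_projCone hx)
        change eval _ _ = 0 at this
        rw [map_mul, mul_eq_zero] at this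
        rcases this with h | h
        · left
          rintro _ rfl v hv
          exact eval_eq_zero_of_mem_submodule hf x.rep_nonzero (rep_mem_submodule x) h hv
        · right
          rintro _ rfl v hv
          exact eval_eq_zero_of_mem_submodule hg x.rep_nonzero (rep_mem_submodule x) h hv
      rcases hirr _ _ ⟨{f}, by rintro _ rfl; exact ⟨d, hf⟩, rfl⟩
        ⟨{g}, by rintro _ rfl; exact ⟨d', hg⟩, rfl⟩ hsub with h | h
      · left
        rintro v ⟨x, hx, hv⟩
        exact h hx f rfl v hv
      · right
        rintro v ⟨x, hx, hv⟩
        exact h hx g rfl v hv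
  · intro v hv
    by_cases hv0 : v = 0
    · rw [hv0]
      exact ⟨x₀, hx₀, zero_mem _⟩
    refine ⟨Projectivization.mk ℂ v hv0, ?_, ?_⟩
    · rw [hδS]
      intro f hf w hw
      obtain ⟨d, hd⟩ := hS f hf
      refine eval_eq_zero_of_mem_submodule hd hv0 ?_ (hv f ?_) hw
      · rw [Projectivization.submodule_mk]
        exact Submodule.mem_span_singleton_self v
      · rintro u ⟨x, hx, hu⟩
        rw [hδS] at hx
        exact hx f hf u hu
    · rw [Projectivization.submodule_mk]
      exact Submodule.mem_span_singleton_self v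

/-- An irreducible curve whose finite hyperplane sections have at most `e` points. -/
structure IsIrredCurve (δ : Set (PS ℂ n)) (e : ℕ) : Prop where
  irred : IsIrredAlg δ
  infinite : δ.Infinite
  exists_hyp : ∃ S : Set (PS ℂ n), IsHypSet S ∧ (δ ∩ S).Finite
  ncard_le : ∀ S : Set (PS ℂ n), IsHypSet S → (δ ∩ S).Finite → (δ ∩ S).ncard ≤ e

lemma IsCurveDeg.isIrredCurve {δ : Set (PS ℂ n)} {e : ℕ} (hδ : IsIrredAlg δ)
    (h : IsCurveDeg δ e) : IsIrredCurve δ e :=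
  ⟨hδ, h.1.2.2 δ ⟨hδ, subset_rfl, fun _ _ h1 h2 => h2.antisymm h1⟩, h.1.2.1,
    fun S hS hfin => h.2.2 ⟨S, hS, hfin, rfl⟩⟩

lemma exists_dual_vanishing_forall_ne_zero {K V : Type*} [Field K] [Infinite K] [AddCommGroup V]
    [Module K V] (W : Submodule K V) {F : Set V} (hF : F.Finite) (hFW : ∀ v ∈ F, v ∉ W) :
    ∃ φ : Module.Dual K V, (∀ v ∈ W, φ v = 0) ∧ ∀ v ∈ F, φ v ≠ 0 := by
  have := hF.to_subtype
  obtain ⟨g, hg⟩ := Module.exists_dual_forall_apply_ne_zero (K := K)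
    (fun v : F => W.mkQ v) fun v h => hFW v v.2 (by simpa using h)
  exact ⟨g ∘ₗ W.mkQ, fun v hv => by simp [(Submodule.Quotient.mk_eq_zero W).2 hv],
    fun v hv => hg ⟨v, hv⟩⟩

lemma isHypSet_ker {φ : Module.Dual ℂ (Fin (n + 1) → ℂ)} (hφ : φ ≠ 0) :
    IsHypSet {x : PS ℂ n | x.submodule ≤ LinearMap.ker φ} := by
  refine ⟨LinearMap.ker φ, ?_, rfl⟩
  have := Module.Dual.finrank_ker_add_one_of_ne_zero hφ
  rw [Module.finrank_fin_fun] at this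
  omega

lemma submodule_le_ker {x : PS ℂ n} {φ : Module.Dual ℂ (Fin (n + 1) → ℂ)} :
    x.submodule ≤ LinearMap.ker φ ↔ φ x.rep = 0 := by
  rw [Projectivization.submodule_eq, Submodule.span_singleton_le_iff_mem, LinearMap.mem_ker]

variable {δ : Set (PS ℂ n)} {e : ℕ} {s t : Module.Dual ℂ (Fin (n + 1) → ℂ)}

lemma common_zero_of_rep (h : ∀ x ∈ δ, s x.rep = 0 → t x.rep ≠ 0) :
    ∀ v ∈ projCone δ, s v = 0 → t v = 0 → v = 0 := by
  rintro v ⟨x, hx, hv⟩ h1 h2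
  by_contra hv0
  obtain ⟨c, rfl⟩ := mem_submodule_iff.1 hv
  have hc : c ≠ 0 := by rintro rfl; simp at hv0
  simp only [map_smul, smul_eq_mul, mul_eq_zero, hc, false_or] at h1 h2
  exact h x hx h1 h2

lemma finite_pencil_section (hδ : IsIrredCurve δ e)
    (hst : ∀ v ∈ projCone δ, s v = 0 → t v = 0 → v = 0) {a b : ℂ} (hab : a ≠ 0 ∨ b ≠ 0) :
    {x ∈ δ | b * s x.rep = a * t x.rep}.Finite := by
  have hex : ∀ x : PS ℂ n, ∃ c : ℂ, x ∈ δ → b * s x.rep = a * t x.rep →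
      c ≠ 0 ∧ s (c • x.rep) = a ∧ t (c • x.rep) = b := by
    intro x
    by_cases hx : x ∈ δ ∧ b * s x.rep = a * t x.rep
    · obtain ⟨hx, he⟩ := hx
      have hne := hst _ (rep_mem_projCone hx)
      by_cases hs : s x.rep = 0
      · have ht : t x.rep ≠ 0 := fun ht => x.rep_nonzero (hne hs ht)
        have ha : a = 0 := by
          rw [hs, mul_zero, eq_comm, mul_eq_zero] at he
          exact he.resolve_right ht
        have hb : b ≠ 0 := by simpa [ha] using hab
        refine ⟨b / t x.rep, fun _ _ => ⟨div_ne_zero hb ht, by simp [hs, ha], ?_⟩⟩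
        simp [div_mul_cancel₀ _ ht]
      · have ha : a ≠ 0 := by
          rintro rfl
          rw [zero_mul, mul_eq_zero] at he
          rcases he with h | h
          · simp [h] at hab
          · exact hs h
        refine ⟨a / s x.rep, fun _ _ => ⟨div_ne_zero ha hs, ?_, ?_⟩⟩
        · simp [div_mul_cancel₀ _ hs]
        · rw [map_smul, smul_eq_mul, div_mul_eq_mul_div, ← he, mul_div_cancel_right₀ _ hs]
    · exact ⟨0, fun h1 h2 => absurd ⟨h1, h2⟩ hx⟩
  choose c hc using hex
  refine Set.Finite.of_finite_image (f := fun x => c x • x.rep)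
    ((pencil_fiber_finite hδ.irred.isIrredCone hst a b).subset ?_) ?_
  · rintro _ ⟨x, ⟨hx, he⟩, rfl⟩
    exact ⟨smul_mem_projCone _ (rep_mem_projCone hx), (hc x hx he).2⟩
  · rintro x ⟨hx, he⟩ y ⟨hy, he'⟩ h
    refine eq_of_mem_submodule (smul_ne_zero (hc x hx he).1 x.rep_nonzero)
      (x.submodule.smul_mem _ (rep_mem_submodule x)) ?_
    simp only at h
    rw [h]
    exact y.submodule.smul_mem _ (rep_mem_submodule y)

lemma infinite_section_eq_one (hδ : IsIrredCurve δ e)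
    (hst : ∀ v ∈ projCone δ, s v = 0 → t v = 0 → v = 0) :
    {v | v ∈ projCone δ ∧ s v = 1}.Infinite := by
  intro hfin
  refine hδ.infinite (Set.Finite.subset (s := {x ∈ δ | 1 * s x.rep = 0 * t x.rep} ∪
    {x ∈ δ | s x.rep ≠ 0}) ?_ ?_)
  · refine (finite_pencil_section hδ hst (Or.inr one_ne_zero)).union ?_
    refine Set.Finite.of_finite_image (f := fun x => (s x.rep)⁻¹ • x.rep) (hfin.subset ?_) ?_
    · rintro _ ⟨x, ⟨hx, he⟩, rfl⟩
      exact ⟨smul_mem_projCone _ (rep_mem_projCone hx), by simp [inv_mul_cancel₀ he]⟩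
    · rintro x ⟨hx, he⟩ y ⟨hy, he'⟩ h
      refine eq_of_mem_submodule (smul_ne_zero (inv_ne_zero he) x.rep_nonzero)
        (x.submodule.smul_mem _ (rep_mem_submodule x)) ?_
      simp only at h
      rw [h]
      exact y.submodule.smul_mem _ (rep_mem_submodule y)
  · intro x hx
    by_cases h : s x.rep = 0
    · left; exact ⟨hx, by simp [h]⟩
    · right; exact ⟨hx, h⟩

lemma card_fiber_le (hδ : IsIrredCurve δ e)
    (hst : ∀ v ∈ projCone δ, s v = 0 → t v = 0 → v = 0) (a b : ℂ) (hab : a ≠ 0 ∨ b ≠ 0)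
    (F : Finset (Fin (n + 1) → ℂ)) (hF : ∀ v ∈ F, v ∈ projCone δ ∧ s v = a ∧ t v = b) :
    F.card ≤ e := by
  have hfin := finite_pencil_section hδ hst hab
  have heq : {x ∈ δ | b * s x.rep = a * t x.rep} =
      δ ∩ {x | x.submodule ≤ LinearMap.ker (b • s - a • t)} := by
    ext x
    simp [submodule_le_ker, sub_eq_zero]
  have hne : b • s - a • t ≠ 0 := by
    intro h0
    refine hδ.infinite (hfin.subset fun x hx => ⟨hx, ?_⟩)
    have := DFunLike.congr_fun h0 x.rep
    simpa [sub_eq_zero] using this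
  have hcard := hδ.ncard_le _ (isHypSet_ker hne) (heq ▸ hfin)
  refine le_trans ?_ hcard
  rw [← heq, Set.ncard_eq_toFinset_card _ hfin]
  have hex : ∀ v : Fin (n + 1) → ℂ, ∃ x : PS ℂ n, v ∈ F → x ∈ δ ∧ v ∈ x.submodule := by
    intro v
    by_cases hv : v ∈ F
    · obtain ⟨x, hx⟩ := (hF v hv).1
      exact ⟨x, fun _ => hx⟩
    · obtain ⟨x, -⟩ := hδ.irred.2.1
      exact ⟨x, fun h => absurd h hv⟩
  choose p hp using hex
  refine Finset.card_le_card_of_injOn p ?_ ?_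
  · intro v hv
    obtain ⟨hx, hvx⟩ := hp v hv
    obtain ⟨c, hc⟩ := mem_submodule_iff.1 hvx
    have h1 := (hF v hv).2
    rw [← hc, map_smul, map_smul, smul_eq_mul, smul_eq_mul] at h1
    have hc0 : c ≠ 0 := by
      rintro rfl
      simp only [zero_mul] at h1
      exact hab.elim (fun h => h h1.1.symm) (fun h => h h1.2.symm)
    simp only [Set.Finite.coe_toFinset, Set.mem_ofPred_eq]
    refine ⟨hx, ?_⟩
    rw [← h1.1, ← h1.2]; ring
  · intro v hv w hw h
    obtain ⟨-, hvx⟩ := hp v hv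
    obtain ⟨-, hwx⟩ := hp w hw
    rw [← h] at hwx
    have hv0 : v ≠ 0 := by
      rintro rfl
      have := (hF 0 hv).2
      simp only [map_zero] at this
      exact hab.elim (fun h => h this.1.symm) (fun h => h this.2.symm)
    rw [eq_mk_of_mem_submodule hv0 hvx, Projectivization.submodule_mk,
      Submodule.mem_span_singleton] at hwx
    obtain ⟨c, rfl⟩ := hwx
    have h1 := (hF v hv).2
    have h2 := (hF _ hw).2
    rw [map_smul, map_smul, h1.1, h1.2, smul_eq_mul, smul_eq_mul] at h2
    have : c = 1 := by
      rcases hab with h | h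
      · exact mul_right_cancel₀ h (by rw [h2.1, one_mul])
      · exact mul_right_cancel₀ h (by rw [h2.2, one_mul])
    rw [this, one_smul]

lemma exists_pencil (hδ : IsIrredCurve δ e) : ∃ s t : Module.Dual ℂ (Fin (n + 1) → ℂ),
    ∀ v ∈ projCone δ, s v = 0 → t v = 0 → v = 0 := by
  obtain ⟨S, ⟨W, hW, rfl⟩, hfin⟩ := hδ.exists_hyp
  have hlt : W < ⊤ := by
    rw [lt_top_iff_ne_top]
    rintro rfl
    rw [finrank_top, Module.finrank_fin_fun] at hW
    omega
  obtain ⟨s, hs0, hs⟩ := Submodule.exists_le_ker_of_lt_top W hlt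
  have hWs : W = LinearMap.ker s := by
    refine Submodule.eq_of_le_of_finrank_eq hs ?_
    have := Module.Dual.finrank_ker_add_one_of_ne_zero hs0
    rw [Module.finrank_fin_fun] at this
    omega
  obtain ⟨t, -, ht⟩ := exists_dual_vanishing_forall_ne_zero (K := ℂ) (⊥ : Submodule ℂ (Fin (n + 1) → ℂ))
    (hfin.image Projectivization.rep) (by
      rintro _ ⟨x, -, rfl⟩
      simpa using x.rep_nonzero)
  refine ⟨s, t, common_zero_of_rep fun x hx h => ht _ ⟨x, ⟨hx, ?_⟩, rfl⟩⟩
  rw [Set.mem_ofPred_eq, hWs]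
  exact submodule_le_ker.2 h

/-- Any finite set of points on the curve is separated by a pencil without base points. -/
lemma exists_separating_pencil (hδ : IsIrredCurve δ e) (T : Finset (PS ℂ n)) (hT : ∀ x ∈ T, x ∈ δ) :
    ∃ s t : Module.Dual ℂ (Fin (n + 1) → ℂ),
      (∀ v ∈ projCone δ, s v = 0 → t v = 0 → v = 0) ∧ (∀ x ∈ T, s x.rep ≠ 0) ∧
      ∀ x ∈ T, ∀ y ∈ T, s x.rep * t y.rep = s y.rep * t x.rep → x = y := by
  obtain ⟨s₀, t₀, hst⟩ := exists_pencil hδ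
  obtain ⟨g, -, hg⟩ := exists_dual_vanishing_forall_ne_zero (K := ℂ) (⊥ : Submodule ℂ (ℂ × ℂ))
    (F := insert (1, 0) ((fun x : PS ℂ n => (s₀ x.rep, t₀ x.rep)) '' (T : Set (PS ℂ n))))
    ((T.finite_toSet.image _).insert _) (by
      rintro v (rfl | ⟨x, hx, rfl⟩)
      · simp
      · intro h
        simp only [Submodule.mem_bot, Prod.mk_eq_zero] at h
        exact x.rep_nonzero (hst _ (rep_mem_projCone (hT x hx)) h.1 h.2))
  let s : Module.Dual ℂ (Fin (n + 1) → ℂ) := g ∘ₗ (s₀.prod t₀)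
  have hsv : ∀ v, s v = s₀ v * g (1, 0) + t₀ v * g (0, 1) := by
    intro v
    have : (s₀ v, t₀ v) = s₀ v • ((1, 0) : ℂ × ℂ) + t₀ v • ((0, 1) : ℂ × ℂ) := by simp
    change g (s₀ v, t₀ v) = _
    rw [this, map_add, map_smul, map_smul, smul_eq_mul, smul_eq_mul]
  have hfin : {x ∈ δ | s x.rep = 0}.Finite := by
    refine (finite_pencil_section hδ hst (a := -g (0, 1)) (b := g (1, 0))
      (Or.inr (hg _ (Set.mem_insert _ _)))).subset ?_
    rintro x ⟨hx, h⟩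
    rw [hsv] at h
    exact ⟨hx, by linear_combination h⟩
  have hsT : ∀ x ∈ T, s x.rep ≠ 0 := fun x hx => hg _ (Set.mem_insert_of_mem _ ⟨x, hx, rfl⟩)
  obtain ⟨t, -, ht⟩ := exists_dual_vanishing_forall_ne_zero (K := ℂ)
    (⊥ : Submodule ℂ (Fin (n + 1) → ℂ))
    (F := (Projectivization.rep '' {x ∈ δ | s x.rep = 0}) ∪
      ((fun q : PS ℂ n × PS ℂ n => s q.1.rep • q.2.rep - s q.2.rep • q.1.rep) ''
        ((T ×ˢ T).filter fun q => q.1 ≠ q.2 : Finset _)))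
    ((hfin.image _).union ((Finset.finite_toSet _).image _)) (by
      rintro _ (⟨x, -, rfl⟩ | ⟨⟨x, y⟩, hxy, rfl⟩)
      · simpa using x.rep_nonzero
      · simp only [Finset.coe_filter, Finset.mem_product, Set.mem_ofPred_eq] at hxy
        intro h
        simp only [Submodule.mem_bot, sub_eq_zero] at h
        refine hxy.2 (eq_of_mem_submodule (v := s x.rep • y.rep)
          (smul_ne_zero (hsT x hxy.1.1) y.rep_nonzero) ?_ ?_)
        · rw [h]
          exact x.submodule.smul_mem _ (rep_mem_submodule x)
        · exact y.submodule.smul_mem _ (rep_mem_submodule y))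
  refine ⟨s, t, common_zero_of_rep fun x hx h => ht _ (Or.inl ⟨x, ⟨hx, h⟩, rfl⟩), hsT, ?_⟩
  intro x hx y hy h
  by_contra hne
  refine ht _ (Or.inr ⟨(x, y), ?_, rfl⟩) ?_
  · simp [hx, hy, hne]
  · simp [h]

/-- A form of degree `m` that does not vanish identically on a curve of degree `e` has at most
`m * e` zeros on it. -/
lemma card_zeros_le (hδ : IsIrredCurve δ e) {m : ℕ} {G : MvPolynomial (Fin (n + 1)) ℂ}
    (hG : G.IsHomogeneous m) (hne : ∃ x ∈ δ, eval x.rep G ≠ 0) (T : Finset (PS ℂ n))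
    (hT : ∀ x ∈ T, x ∈ δ ∧ eval x.rep G = 0) : T.card ≤ m * e := by
  obtain ⟨s, t, hst, hs, hsep⟩ := exists_separating_pencil hδ T fun x hx => (hT x hx).1
  obtain ⟨k, hk0, hke, c, hc, hrel, hc0⟩ := exists_homogeneous_equation hδ.irred.isIrredCone hst
    (infinite_section_eq_one hδ hst) (card_fiber_le hδ hst) hG
  obtain ⟨x₀, hx₀, hGx₀⟩ := hne
  have hc0 := hc0 ⟨_, rep_mem_projCone hx₀, hGx₀⟩
  let f := aeval ![1, (Polynomial.X : Polynomial ℂ)] (c 0)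
  have hf0 : f ≠ 0 := aeval_one_X_ne_zero (hc 0 hk0) hc0
  have hroot : ∀ x ∈ T, t x.rep / s x.rep ∈ f.roots.toFinset := by
    intro x hx
    have h1 := hrel _ (rep_mem_projCone (hT x hx).1)
    rw [(hT x hx).2, zero_pow hk0.ne', zero_add, Finset.sum_eq_single 0 (fun i _ hi => by
      rw [zero_pow hi, mul_zero]) (fun h => absurd (Finset.mem_range.2 hk0) h), pow_zero,
      mul_one] at h1
    have h2 : ![s x.rep, t x.rep] = s x.rep • ![1, t x.rep / s x.rep] := by
      simp [mul_div_cancel₀ _ (hs x hx)]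
    rw [h2, eval_smul_of_isHomogeneous (hc 0 hk0), mul_eq_zero] at h1
    have h3 := h1.resolve_left (pow_ne_zero _ (hs x hx))
    simpa [hf0, f, eval_aeval_one_X] using h3
  calc T.card = (T.image fun x => t x.rep / s x.rep).card := by
        rw [Finset.card_image_of_injOn]
        intro x hx y hy h
        refine hsep x hx y hy ?_
        simp only at h
        rw [div_eq_div_iff (hs x hx) (hs y hy)] at h
        linear_combination -h
    _ ≤ f.roots.toFinset.card := Finset.card_le_card (by
        intro τ hτ
        obtain ⟨x, hx, rfl⟩ := Finset.mem_image.1 hτ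
        exact hroot x hx)
    _ ≤ f.natDegree := (Multiset.toFinset_card_le _).trans (Polynomial.card_roots' f)
    _ ≤ m * k := by simpa using natDegree_aeval_one_X_le (hc 0 hk0)
    _ ≤ m * e := Nat.mul_le_mul_left m hke

lemma finite_zeros (hδ : IsIrredCurve δ e) {m : ℕ} {G : MvPolynomial (Fin (n + 1)) ℂ}
    (hG : G.IsHomogeneous m) (hne : ∃ x ∈ δ, eval x.rep G ≠ 0) :
    {x ∈ δ | eval x.rep G = 0}.Finite ∧ {x ∈ δ | eval x.rep G = 0}.ncard ≤ m * e := by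
  have hfin : {x ∈ δ | eval x.rep G = 0}.Finite := by
    by_contra hinf
    obtain ⟨T, hT, hcard⟩ := Set.Infinite.exists_subset_card_eq hinf (m * e + 1)
    have := card_zeros_le hδ hG hne T fun x hx => hT hx
    omega
  refine ⟨hfin, ?_⟩
  rw [Set.ncard_eq_toFinset_card _ hfin]
  exact card_zeros_le hδ hG hne _ fun x hx => hfin.mem_toFinset.1 hx

lemma finite_inter_of_ne {δ' : Set (PS ℂ n)} {e' : ℕ} (hδ : IsIrredCurve δ e)
    (hδ' : IsIrredCurve δ' e') (hne : δ ≠ δ') : (δ ∩ δ').Finite := by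
  have key : ∀ {δ δ' : Set (PS ℂ n)} {e : ℕ}, IsIrredCurve δ e → IsAlg δ' → ¬ δ ⊆ δ' →
      (δ ∩ δ').Finite := by
    rintro δ δ' e hδ ⟨S, hS, rfl⟩ hsub
    obtain ⟨x, hx, hxS⟩ := Set.not_subset.1 hsub
    simp only [projZeroLocus, Set.mem_ofPred_eq, not_forall] at hxS
    obtain ⟨f, hf, v, hv, hfv⟩ := hxS
    obtain ⟨d, hd⟩ := hS f hf
    refine (finite_zeros hδ hd ⟨x, hx, fun h => hfv (eval_eq_zero_of_mem_submodule hd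
      x.rep_nonzero (rep_mem_submodule x) h hv)⟩).1.subset ?_
    rintro y ⟨hy, hyS⟩
    exact ⟨hy, hyS f hf _ (rep_mem_submodule y)⟩
  by_cases h : δ ⊆ δ'
  · rw [Set.inter_comm]
    exact key hδ' hδ.irred.1 fun h' => hne (h.antisymm h')
  · exact key hδ hδ'.irred.1 h

lemma dual_eq_zero_of_infinite (hδ : IsIrredCurve δ e) {φ : Module.Dual ℂ (Fin (n + 1) → ℂ)}
    (h : {x ∈ δ | φ x.rep = 0}.Infinite) : ∀ v ∈ projCone δ, φ v = 0 := by
  by_contra! hne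
  obtain ⟨v, ⟨x, hx, hv⟩, hφ⟩ := hne
  obtain ⟨c, rfl⟩ := mem_submodule_iff.1 hv
  refine h ?_
  have := (finite_zeros hδ (isHomogeneous_linForm φ) ⟨x, hx, fun h => hφ ?_⟩).1
  · simpa only [eval_linForm] using this
  · rw [eval_linForm] at h
    rw [map_smul, h, smul_zero]

/-- If the line through `a` and `b` misses the curve, there is a form of degree at most `e`
cutting out a cone over the curve with vertex `a` that does not contain `b`. -/
lemma exists_cone_form (hδ : IsIrredCurve δ e) {a b : Fin (n + 1) → ℂ}
    (hab : b ∉ Submodule.span ℂ {a})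
    (hline : ∀ v ∈ projCone δ, v ∈ Submodule.span ℂ {a, b} → v = 0) :
    ∃ k ≤ e, ∃ G : MvPolynomial (Fin (n + 1)) ℂ, G.IsHomogeneous k ∧
      (∀ v ∈ projCone δ, eval v G = 0) ∧ (∀ (c : ℂ) v, eval (v + c • a) G = eval v G) ∧
      eval a G = 0 ∧ eval b G ≠ 0 := by
  obtain ⟨x₀, hx₀⟩ := hδ.irred.2.1
  have hout : ∀ x ∈ δ, x.rep ∉ Submodule.span ℂ {a, b} := fun x hx h =>
    x.rep_nonzero (hline _ (rep_mem_projCone hx) h)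
  obtain ⟨s, hsW, hs⟩ := exists_dual_vanishing_forall_ne_zero (K := ℂ) (Submodule.span ℂ {a, b})
    (Set.finite_singleton x₀.rep) (by rintro _ rfl; exact hout x₀ hx₀)
  have hfin : {x ∈ δ | s x.rep = 0}.Finite := by
    by_contra h
    exact hs _ rfl (dual_eq_zero_of_infinite hδ h _ (rep_mem_projCone hx₀))
  obtain ⟨t, htW, ht⟩ := exists_dual_vanishing_forall_ne_zero (K := ℂ) (Submodule.span ℂ {a, b})
    (hfin.image Projectivization.rep) (by rintro _ ⟨x, hx, rfl⟩; exact hout x hx.1)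
  obtain ⟨u, hua, hub⟩ := exists_dual_vanishing_forall_ne_zero (K := ℂ) (Submodule.span ℂ {a})
    (Set.finite_singleton b) (by rintro _ rfl; exact hab)
  have hst : ∀ v ∈ projCone δ, s v = 0 → t v = 0 → v = 0 :=
    common_zero_of_rep fun x hx h => ht _ ⟨x, ⟨hx, h⟩, rfl⟩
  obtain ⟨k, hk0, hke, c, hc, hrel, -⟩ := exists_homogeneous_equation hδ.irred.isIrredCone hst
    (infinite_section_eq_one hδ hst) (card_fiber_le hδ hst) (isHomogeneous_linForm u)
  let G := linForm u ^ k + ∑ i ∈ Finset.range k,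
    aeval ![linForm s, linForm t] (c i) * linForm u ^ i
  have hGv : ∀ v, eval v G = u v ^ k + ∑ i ∈ Finset.range k, eval ![s v, t v] (c i) * u v ^ i := by
    intro v
    simp only [G, map_add, map_sum, map_mul, map_pow, eval_aeval_linForm, eval_linForm]
  have ha : a ∈ Submodule.span ℂ {a, b} := Submodule.subset_span (by simp)
  have hb : b ∈ Submodule.span ℂ {a, b} := Submodule.subset_span (by simp)
  have hua' := hua a (Submodule.mem_span_singleton_self a)
  have hcz : ∀ i ∈ Finset.range k, eval ![0, 0] (c i) = 0 := by
    intro i hi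
    have hi := Finset.mem_range.1 hi
    have := eval_smul_of_isHomogeneous (hc i hi) 0 ![0, 0]
    rwa [zero_pow (by omega), zero_mul,
      show (0 : ℂ) • ![(0 : ℂ), 0] = ![0, 0] by ext i; fin_cases i <;> simp] at this
  refine ⟨k, hke, G, ?_, ?_, ?_, ?_, ?_⟩
  · refine IsHomogeneous.add (by simpa using (isHomogeneous_linForm u).pow k)
      (IsHomogeneous.sum _ _ _ fun i hi => ?_)
    have hl : ∀ i, (![linForm s, linForm t] i).IsHomogeneous 1 := by
      intro i
      fin_cases i <;> exact isHomogeneous_linForm _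
    have hi := Finset.mem_range.1 hi
    have := ((hc i hi).aeval _ hl).mul ((isHomogeneous_linForm u).pow i)
    simp only [one_mul] at this
    rwa [Nat.sub_add_cancel hi.le] at this
  · intro v hv
    rw [hGv]
    simpa only [eval_linForm] using hrel v hv
  · intro d v
    rw [hGv, hGv]
    simp only [map_add, map_smul, hsW a ha, htW a ha, hua', smul_zero, add_zero]
  · rw [hGv, hsW a ha, htW a ha, hua', zero_pow hk0.ne', zero_add]
    exact Finset.sum_eq_zero fun i hi => by rw [hcz i hi, zero_mul]
  · rw [hGv, hsW b hb, htW b hb, Finset.sum_eq_zero fun i hi => by rw [hcz i hi, zero_mul],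
      add_zero]
    exact pow_ne_zero _ (hub b rfl)

end curve

/-- A derivation extends along a formally étale algebra. -/
lemma Derivation.exists_extension_of_formallyEtale {R S T : Type*} [CommRing R] [CommRing S]
    [CommRing T] [Algebra R S] [Algebra R T] [Algebra S T] [IsScalarTower R S T]
    [Algebra.FormallyEtale S T] (d : Derivation R S T) :
    ∃ D : Derivation R T T, ∀ x, D (algebraMap S T x) = d x := by
  refine ⟨((d.liftKaehlerDifferential.liftBaseChange T) ∘ₗ
    (KaehlerDifferential.tensorKaehlerEquivOfFormallyEtale R S T).symm.toLinearMap).compDer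
      (KaehlerDifferential.D R T), fun x => ?_⟩
  simp [KaehlerDifferential.tensorKaehlerEquivOfFormallyEtale_symm_D_algebraMap]

lemma exists_derivation_apply_eq_one {K L : Type*} [Field K] [Field L] [Algebra K L] [CharZero K]
    {t : L} (ht : Transcendental K t) : ∃ D : Derivation K L L, D t = 1 := by
  obtain ⟨B, htB, hB⟩ := exists_isTranscendenceBasis_superset (R := K) (s := {t})
    (algebraicIndependent_unique_type_iff.2 ht)
  let A := MvPolynomial B K
  let _ : Algebra A L := (aeval (R := K) ((↑) : B → L)).toAlgebra
  have hmap : ∀ f : A, algebraMap A L f = aeval (R := K) ((↑) : B → L) f := fun f => rfl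
  have : IsScalarTower K A L := IsScalarTower.of_algebraMap_eq fun x => by
    rw [hmap]; simp [A]
  have hinj : Function.Injective (algebraMap A L) := hB.1
  have : FaithfulSMul A L := (faithfulSMul_iff_algebraMap_injective A L).2 hinj
  have halg := hB.isAlgebraic
  have : Algebra.IsAlgebraic A L := .of_ringHom_of_comp_eq hB.1.aevalEquiv.toRingEquiv.toRingHom
    (RingHom.id L) hB.1.aevalEquiv.surjective Function.injective_id (by
      ext x <;> simp [hmap, A])
  let _ : Algebra (FractionRing A) L := FractionRing.liftAlgebra A L
  have : Algebra.IsAlgebraic (FractionRing A) L := .extendScalars (R := A)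
    (IsFractionRing.injective A (FractionRing A))
  have : CharZero (FractionRing A) := inferInstance
  have : Algebra.FormallyEtale (FractionRing A) L := Algebra.FormallyEtale.of_isSeparable _ _
  have : Algebra.FormallyEtale A (FractionRing A) :=
    Algebra.FormallyEtale.of_isLocalization (nonZeroDivisors A)
  have : Algebra.FormallyEtale A L := .comp A (FractionRing A) L
  obtain ⟨D, hD⟩ := Derivation.exists_extension_of_formallyEtale
    (mkDerivation K (fun _ => 1 : B → L))
  refine ⟨D, ?_⟩
  have := hD (X ⟨t, htB rfl⟩)
  rw [hmap, aeval_X, mkDerivation_X] at this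
  exact this

/-- The field of constants of a derivation. -/
def Derivation.constantField {L : Type*} [Field L] (D : Derivation ℤ L L) : Subfield L where
  carrier := {x | D x = 0}
  mul_mem' := by intro a b ha hb; simp_all
  one_mem' := by simp
  add_mem' := by intro a b ha hb; simp_all
  zero_mem' := by simp
  neg_mem' := by intro a ha; simp_all
  inv_mem' := by intro a ha; simp_all [Derivation.leibniz_inv]

lemma Derivation.eq_zero_of_isAlgebraic {L : Type*} [Field L] [CharZero L] (D : Derivation ℤ L L)
    {x : L} (hx : IsAlgebraic D.constantField x) : D x = 0 := by
  let D' : Derivation D.constantField L L :=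
    { toFun := D
      map_add' := map_add D
      map_smul' := fun a y => by
        have ha : D a = 0 := a.2
        change D ((a : L) * y) = (a : L) * D y
        simp [ha]
      map_one_eq_zero' := D.map_one_eq_zero
      leibniz' := D.leibniz }
  have h := D'.map_aeval (minpoly D.constantField x) x
  rw [minpoly.aeval, map_zero] at h
  have hsep := (minpoly.irreducible hx.isIntegral).separable
  exact (smul_eq_zero.1 h.symm).resolve_left
    (hsep.aeval_derivative_ne_zero (minpoly.aeval _ x))

lemma Subfield.exists_derivation_apply_eq_one {L : Type*} [Field L] [CharZero L] (E : Subfield L)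
    {t : L} (ht : ¬ IsAlgebraic E t) :
    ∃ D : Derivation ℤ L L, (∀ x ∈ E, D x = 0) ∧ D t = 1 := by
  obtain ⟨D, hD⟩ := _root_.exists_derivation_apply_eq_one (K := E) (t := t) ht
  exact ⟨D.restrictScalars ℤ, fun x hx => D.map_algebraMap ⟨x, hx⟩, hD⟩

lemma Subfield.countable_closure {L : Type*} [Field L] {A : Set L} (hA : A.Countable) :
    Countable (Subfield.closure A) := by
  rw [← Cardinal.mk_le_aleph0_iff]
  refine (Subfield.cardinalMk_closure_le_max A).trans (max_le ?_ le_rfl)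
  have := hA.to_subtype
  exact Cardinal.mk_le_aleph0

section

variable {n : ℕ} {δ : Set (PS ℂ n)} {e : ℕ} {s t : Module.Dual ℂ (Fin (n + 1) → ℂ)}

/-- A curve is defined over a countable field: a derivation vanishing on it and on the two
coordinates of a pencil at a point of the cone vanishes on all the coordinates of that point. -/
lemma exists_countable_forall_derivation_eq_zero (hδ : IsIrredCurve δ e)
    (hst : ∀ v ∈ projCone δ, s v = 0 → t v = 0 → v = 0) :
    ∃ A : Set ℂ, A.Countable ∧ ∀ D : Derivation ℤ ℂ ℂ, (∀ a ∈ A, D a = 0) →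
      ∀ v ∈ projCone δ, D (s v) = 0 → D (t v) = 0 → ∀ j, D (v j) = 0 := by
  have := fun j : Fin (n + 1) => exists_homogeneous_equation hδ.irred.isIrredCone hst
    (infinite_section_eq_one hδ hst) (card_fiber_le hδ hst) (isHomogeneous_X ℂ j)
  choose k hk0 hke c hc hrel hc0 using this
  refine ⟨⋃ j, ⋃ i, Set.range fun m => (c j i).coeff m, Set.countable_iUnion fun j =>
    Set.countable_iUnion fun i => Set.countable_range _, fun D hD v hv hs ht j => ?_⟩
  refine D.eq_zero_of_isAlgebraic (IsIntegral.isAlgebraic ?_)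
  have hmem : ∀ i, eval ![s v, t v] (c j i) ∈ D.constantField := fun i => by
    refine eval_mem (fun m _ => hD _ ?_) fun l => ?_
    · exact Set.mem_iUnion.2 ⟨j, Set.mem_iUnion.2 ⟨i, m, rfl⟩⟩
    · fin_cases l
      exacts [hs, ht]
  let P : Polynomial D.constantField := ∑ i ∈ Finset.range (k j),
    Polynomial.C ⟨_, hmem i⟩ * Polynomial.X ^ i
  refine ⟨Polynomial.X ^ k j + P, Polynomial.monic_X_pow_add ?_, ?_⟩
  · refine (Polynomial.degree_sum_le _ _).trans_lt ?_
    rw [Finset.sup_lt_iff (WithBot.bot_lt_coe _)]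
    intro i hi
    exact (Polynomial.degree_C_mul_X_pow_le _ _).trans_lt
      (WithBot.coe_lt_coe.2 (Finset.mem_range.1 hi))
  · have := hrel j v hv
    rw [← this]
    simp only [P, Polynomial.eval₂_add, Polynomial.eval₂_finsetSum, Polynomial.eval₂_mul,
      Polynomial.eval₂_C, Polynomial.eval₂_X_pow, eval_X]
    rfl

lemma exists_mem_pencil_eq (hδ : IsIrredCurve δ e)
    (hst : ∀ v ∈ projCone δ, s v = 0 → t v = 0 → v = 0) (a b : ℂ) :
    ∃ v ∈ projCone δ, s v = a ∧ t v = b := by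
  obtain ⟨v, hv, h1, h2, -⟩ := exists_mem_of_isRoot_minpoly hδ.irred.isIrredCone hst 0
    Polynomial.X (fun Q => by
      rw [map_zero, Polynomial.eval₂_at_zero, Polynomial.X_dvd_iff,
        map_eq_zero_iff _ (pencilHom_injective hδ.irred.isIrredCone hst
          (infinite_section_eq_one hδ hst))]) a b 0 (by simp)
  exact ⟨v, hv, h1, h2⟩

/-- Points of a curve avoiding countably many conditions. -/
lemma exists_generic_mem (hδ : IsIrredCurve δ e)
    (hst : ∀ v ∈ projCone δ, s v = 0 → t v = 0 → v = 0) {A : Set ℂ} (hA : A.Countable)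
    {Φ : Set (Module.Dual ℂ (Fin (n + 1) → ℂ))} (hΦ : Φ.Countable) {F : Set (PS ℂ n)}
    (hF : F.Finite) :
    ∃ x ∈ δ, x ∉ F ∧ ∃ v ∈ x.submodule, t v = 1 ∧ s v ∉ A ∧
      ∀ φ ∈ Φ, φ v = 0 → ∀ w ∈ projCone δ, φ w = 0 := by
  let Φ' := {φ ∈ Φ | {x ∈ δ | φ x.rep = 0}.Finite}
  let bad : Set ℂ := A ∪ (fun x : PS ℂ n => s x.rep / t x.rep) ''
    (F ∪ ⋃ φ ∈ Φ', {x ∈ δ | φ x.rep = 0})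
  have hbad : bad.Countable := hA.union <| (hF.countable.union <|
    (hΦ.mono (Set.sep_subset _ _)).biUnion fun φ hφ => hφ.2.countable).image _
  obtain ⟨a, ha⟩ : ∃ a, a ∉ bad := by
    by_contra! h
    exact not_countable_complex (hbad.mono fun a _ => h a)
  obtain ⟨v, ⟨x, hx, hvx⟩, hsv, htv⟩ := exists_mem_pencil_eq hδ hst a 1
  have hquot : s x.rep / t x.rep = a := by
    obtain ⟨c, rfl⟩ := mem_submodule_iff.1 hvx
    rw [map_smul, smul_eq_mul] at hsv htv
    have hc : c ≠ 0 := left_ne_zero_of_mul_eq_one htv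
    have ht := right_ne_zero_of_mul_eq_one htv
    rw [div_eq_iff ht, ← hsv]
    linear_combination (-s x.rep) * htv
  refine ⟨x, hx, fun h => ha (Or.inr ⟨x, Or.inl h, hquot⟩), v, hvx, htv, ?_, ?_⟩
  · rw [hsv]
    exact fun h => ha (Or.inl h)
  · intro φ hφ hφv
    by_contra hne
    have hfin : {x ∈ δ | φ x.rep = 0}.Finite := by
      by_contra h
      exact hne (dual_eq_zero_of_infinite hδ h)
    refine ha (Or.inr ⟨x, Or.inr (Set.mem_biUnion (x := φ) ⟨hφ, hfin⟩ ⟨hx, ?_⟩), hquot⟩)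
    obtain ⟨c, rfl⟩ := mem_submodule_iff.1 hvx
    rw [map_smul, smul_eq_mul] at hφv htv
    exact (mul_eq_zero.1 hφv).resolve_left (left_ne_zero_of_mul_eq_one htv)

lemma exists_le_finrank_eq {K V : Type*} [Field K] [AddCommGroup V] [Module K V]
    [FiniteDimensional K V] (W : Submodule K V) {r : ℕ} (hW : Module.finrank K W ≤ r)
    (hr : r ≤ Module.finrank K V) : ∃ W' : Submodule K V, W ≤ W' ∧ Module.finrank K W' = r := by
  induction r, hW using Nat.le_induction with
  | base => exact ⟨W, le_rfl, rfl⟩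
  | succ r _ ih =>
    obtain ⟨W', hle, hW'⟩ := ih (by omega)
    obtain ⟨v, hv⟩ : ∃ v, v ∉ W' := by
      by_contra! h
      rw [(Submodule.eq_top_iff').2 h, finrank_top] at hW'
      omega
    exact ⟨W' ⊔ Submodule.span K {v}, hle.trans le_sup_left, by
      rw [Submodule.finrank_sup_span_singleton hv, hW']⟩

lemma NonPlanar.exists_rep_notMem (h : NonPlanar δ) (hn : 2 ≤ n)
    {W : Submodule ℂ (Fin (n + 1) → ℂ)} (hW : Module.finrank ℂ W ≤ 3) :
    ∃ x ∈ δ, x.rep ∉ W := by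
  obtain ⟨W', hle, hW'⟩ := exists_le_finrank_eq W hW (by simpa using hn)
  by_contra! hall
  refine h _ ⟨W', hW', rfl⟩ fun x hx v hv => ?_
  obtain ⟨c, rfl⟩ := mem_submodule_iff.1 hv
  exact W'.smul_mem c (hle (hall x hx))

end

section

variable {n : ℕ}

/-- The coefficients of a linear form. -/
def dualCoeffs (φ : Module.Dual ℂ (Fin (n + 1) → ℂ)) : Set ℂ :=
  Set.range fun i => φ fun j => if i = j then 1 else 0

lemma countable_dualCoeffs (φ : Module.Dual ℂ (Fin (n + 1) → ℂ)) : (dualCoeffs φ).Countable :=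
  Set.countable_range _

lemma Derivation.apply_dual {D : Derivation ℤ ℂ ℂ} {φ : Module.Dual ℂ (Fin (n + 1) → ℂ)}
    (h : ∀ a ∈ dualCoeffs φ, D a = 0) (v : Fin (n + 1) → ℂ) :
    D (φ v) = φ fun i => D (v i) := by
  rw [LinearMap.pi_apply_eq_sum_univ φ v, LinearMap.pi_apply_eq_sum_univ φ fun i => D (v i),
    map_sum]
  refine Finset.sum_congr rfl fun i _ => ?_
  rw [smul_eq_mul, D.leibniz, h _ ⟨i, rfl⟩, smul_zero, zero_add, smul_eq_mul, smul_eq_mul, mul_comm]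

lemma exists_smul_add_smul_eq_zero {K : Type*} [Field K] (a b : K) :
    ∃ β γ : K, (β ≠ 0 ∨ γ ≠ 0) ∧ β * a + γ * b = 0 := by
  by_cases ha : a = 0
  · exact ⟨1, 0, Or.inl one_ne_zero, by simp [ha]⟩
  · exact ⟨-b, a, Or.inr ha, by ring⟩

lemma exists_rep_eq_smul {x : PS ℂ n} {v : Fin (n + 1) → ℂ} (hv : v ∈ x.submodule) (h0 : v ≠ 0) :
    ∃ c : ℂ, x.rep = c • v := by
  obtain ⟨c, rfl⟩ := mem_submodule_iff.1 hv
  have hc : c ≠ 0 := by rintro rfl; simp at h0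
  exact ⟨c⁻¹, by rw [smul_smul, inv_mul_cancel₀ hc, one_smul]⟩

lemma finrank_span_pair_le {K V : Type*} [Field K] [AddCommGroup V] [Module K V] (a b : V) :
    Module.finrank K (Submodule.span K {a, b}) ≤ 2 := by
  have h := (finrank_span_finset_le_card (R := K) ({a, b} : Finset V)).trans Finset.card_le_two
  rwa [Finset.coe_insert, Finset.coe_singleton] at h

/-- On the cone over a curve, some nontrivial combination of two derivations kills a suitable
multiple of a given vector. -/
lemma exists_smul_derivation_eq_zero {δ : Set (PS ℂ n)} {s t : Module.Dual ℂ (Fin (n + 1) → ℂ)}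
    {A : Set ℂ} (hst : ∀ v ∈ projCone δ, s v = 0 → t v = 0 → v = 0)
    (hA : ∀ D : Derivation ℤ ℂ ℂ, (∀ a ∈ A, D a = 0) →
      ∀ v ∈ projCone δ, D (s v) = 0 → D (t v) = 0 → ∀ j, D (v j) = 0)
    {D₁ D₂ : Derivation ℤ ℂ ℂ} (h₁ : ∀ a ∈ A, D₁ a = 0) (h₂ : ∀ a ∈ A, D₂ a = 0)
    {v : Fin (n + 1) → ℂ} (hv : v ∈ projCone δ) (hv0 : v ≠ 0) :
    ∃ c β γ : ℂ, c ≠ 0 ∧ (β ≠ 0 ∨ γ ≠ 0) ∧ ∀ j, (β • D₁ + γ • D₂) ((c • v) j) = 0 := by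
  have hk : ∀ β γ : ℂ, ∀ a ∈ A, (β • D₁ + γ • D₂) a = 0 := fun β γ a ha => by
    simp [h₁ a ha, h₂ a ha]
  by_cases hs : s v = 0
  · have ht : t v ≠ 0 := fun h => hv0 (hst v hv hs h)
    refine ⟨(t v)⁻¹, 1, 0, inv_ne_zero ht, Or.inl one_ne_zero,
      hA _ (hk _ _) _ (smul_mem_projCone _ hv) ?_ ?_⟩
    · simp [hs]
    · rw [map_smul, smul_eq_mul, inv_mul_cancel₀ ht, Derivation.map_one_eq_zero]
  · obtain ⟨β, γ, hβγ, h⟩ := exists_smul_add_smul_eq_zero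
      (D₁ ((s v)⁻¹ * t v)) (D₂ ((s v)⁻¹ * t v))
    refine ⟨(s v)⁻¹, β, γ, inv_ne_zero hs, hβγ,
      hA _ (hk _ _) _ (smul_mem_projCone _ hv) ?_ ?_⟩
    · rw [map_smul, smul_eq_mul, inv_mul_cancel₀ hs, Derivation.map_one_eq_zero]
    · rw [map_smul]
      exact h

/-- Some secant line of a non-planar curve misses a given other curve: two points `p`, `q` in
general position can be moved independently along the first curve by derivations of `ℂ`, which
prevents the line through them from following a point of the second curve. -/
lemma exists_secant_disjoint {δ₁ δ₂ : Set (PS ℂ n)} {e₁ e₂ : ℕ} (hn : 2 ≤ n)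
    (h₁ : IsIrredCurve δ₁ e₁) (h₂ : IsIrredCurve δ₂ e₂) (hnp : NonPlanar δ₁) (hne : δ₁ ≠ δ₂) :
    ∃ x ∈ δ₁, ∃ y ∈ δ₁, x ≠ y ∧
      ∀ v ∈ projCone δ₂, v ∈ Submodule.span ℂ {x.rep, y.rep} → v = 0 := by
  by_contra! H
  have hF := finite_inter_of_ne h₁ h₂ hne
  obtain ⟨s₁, t₁, hst₁⟩ := exists_pencil h₁
  obtain ⟨s₂, t₂, hst₂⟩ := exists_pencil h₂
  obtain ⟨A₁, hA₁, hD₁⟩ := exists_countable_forall_derivation_eq_zero h₁ hst₁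
  obtain ⟨A₂, hA₂, hD₂⟩ := exists_countable_forall_derivation_eq_zero h₂ hst₂
  let A := (A₁ ∪ A₂) ∪ (dualCoeffs s₁ ∪ dualCoeffs t₁)
  have hA : A.Countable := (hA₁.union hA₂).union
    ((countable_dualCoeffs _).union (countable_dualCoeffs _))
  let k := Subfield.closure A
  have hk : Countable k := Subfield.countable_closure hA
  have hAk : A ⊆ k := Subfield.subset_closure
  obtain ⟨y, hy, hyF, q, hqy, htq, hsq, -⟩ := exists_generic_mem h₁ hst₁
    (Algebraic.countable k ℂ) Set.countable_empty hF
  have hq0 : q ≠ 0 := by rintro rfl; simp at htq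
  obtain ⟨D, hDk, hDq⟩ := k.exists_derivation_apply_eq_one hsq
  let q' : Fin (n + 1) → ℂ := fun i => D (q i)
  let W := Submodule.span ℂ {q, q'}
  have hW : Module.finrank ℂ W ≤ 2 := finrank_span_pair_le q q'
  obtain ⟨x₁, hx₁, hx₁W⟩ := hnp.exists_rep_notMem hn (W := W) (by omega)
  obtain ⟨x₂, hx₂, hx₂W⟩ := hnp.exists_rep_notMem hn (W := W ⊔ Submodule.span ℂ {x₁.rep}) (by
    rw [Submodule.finrank_sup_span_singleton hx₁W]; omega)
  obtain ⟨φ, hφW, hφx⟩ := exists_dual_vanishing_forall_ne_zero (K := ℂ) W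
    (Set.finite_singleton x₁.rep) (by rintro _ rfl; exact hx₁W)
  obtain ⟨ψ, hψW, hψx⟩ := exists_dual_vanishing_forall_ne_zero (K := ℂ)
    (W ⊔ Submodule.span ℂ {x₁.rep}) (Set.finite_singleton x₂.rep) (by rintro _ rfl; exact hx₂W)
  have hqW : q ∈ W := Submodule.subset_span (by simp)
  have hq'W : q' ∈ W := Submodule.subset_span (by simp)
  have hψx₁ : ψ x₁.rep = 0 :=
    hψW _ (Submodule.mem_sup_right (Submodule.mem_span_singleton_self _))
  replace hψW : ∀ v ∈ W, ψ v = 0 := fun v hv => hψW v (Submodule.mem_sup_left hv)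
  let E := Subfield.closure (A ∪ Set.range q ∪ (dualCoeffs φ ∪ dualCoeffs ψ))
  have hE : Countable E := Subfield.countable_closure
    ((hA.union (Set.countable_range q)).union
      ((countable_dualCoeffs _).union (countable_dualCoeffs _)))
  have hAE : A ⊆ E := fun a ha => Subfield.subset_closure (Or.inl (Or.inl ha))
  have hqE : ∀ i, q i ∈ E := fun i => Subfield.subset_closure (Or.inl (Or.inr ⟨i, rfl⟩))
  have hφE : dualCoeffs φ ⊆ E := fun a ha => Subfield.subset_closure (Or.inr (Or.inl ha))
  have hψE : dualCoeffs ψ ⊆ E := fun a ha => Subfield.subset_closure (Or.inr (Or.inr ha))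
  have halg : {a : ℂ | IsAlgebraic E a}.Countable := Algebraic.countable E ℂ
  obtain ⟨x, hx, hxF, p, hpx, htp, hsp, hΦ⟩ := exists_generic_mem h₁ hst₁ halg
    ((halg.image fun e => ψ - e • φ).insert φ) hF
  have hp0 : p ≠ 0 := by rintro rfl; simp at htp
  have hφp : φ p ≠ 0 := fun h =>
    hφx _ rfl (hΦ φ (Set.mem_insert _ _) h _ (rep_mem_projCone hx₁))
  obtain ⟨D₁, hD₁E, hD₁p⟩ := E.exists_derivation_apply_eq_one hsp
  have hp : p ∈ projCone δ₁ := ⟨x, hx, hpx⟩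
  have hlin : ∀ D' : Derivation ℤ ℂ ℂ, (∀ a ∈ A, D' a = 0) →
      ∀ i, D' (p i) = D' (s₁ p) * D₁ (p i) := by
    intro D' hD' i
    have := hD₁ (D' - D' (s₁ p) • D₁)
      (fun a ha => by
        simp [hD' a (Or.inl (Or.inl ha)), hD₁E a (hAE (Or.inl (Or.inl ha)))]) p hp
      (by simp [hD₁p]) (by simp [htp]) i
    simpa [sub_eq_zero] using this
  let D₂ := D - D (s₁ p) • D₁
  have hD₂A : ∀ a ∈ A, D₂ a = 0 := fun a ha => by simp [D₂, hDk a (hAk ha), hD₁E a (hAE ha)]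
  have hD₂p : ∀ i, D₂ (p i) = 0 := fun i => by
    rw [hlin D₂ hD₂A i]; simp [D₂, hD₁p]
  have hD₁q : ∀ i, D₁ (q i) = 0 := fun i => hD₁E _ (hqE i)
  have hD₂q : ∀ i, D₂ (q i) = q' i := fun i => by simp [D₂, q', hD₁q]
  have hxy : x ≠ y := by
    rintro rfl
    obtain ⟨c, hc⟩ := exists_rep_eq_smul hqy hq0
    obtain ⟨c', hc'⟩ := mem_submodule_iff.1 hpx
    apply hφp
    rw [← hc', hc, map_smul, map_smul, hφW q hqW]
    simp
  obtain ⟨v, hv, hvs, hv0⟩ := H x hx y hy hxy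
  obtain ⟨a, b, ha, hb, rfl⟩ : ∃ a b : ℂ, a ≠ 0 ∧ b ≠ 0 ∧ a • p + b • q = v := by
    obtain ⟨a, b, rfl⟩ := Submodule.mem_span_pair.1 hvs
    obtain ⟨c, hc⟩ := exists_rep_eq_smul hpx hp0
    obtain ⟨d, hd⟩ := exists_rep_eq_smul hqy hq0
    refine ⟨a * c, b * d, ?_, ?_, by rw [hc, hd, smul_smul, smul_smul]⟩
    · intro h
      refine hyF ⟨hy, mem_of_mem_projCone hv0 ?_ hv⟩
      rw [hc, smul_smul, h, zero_smul, zero_add]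
      exact y.submodule.smul_mem _ (rep_mem_submodule y)
    · intro h
      refine hxF ⟨hx, mem_of_mem_projCone hv0 ?_ hv⟩
      rw [hd, smul_smul b, h, zero_smul, add_zero]
      exact x.submodule.smul_mem _ (rep_mem_submodule x)
  obtain ⟨c, β, γ, hc, hβγ, hD₃⟩ := exists_smul_derivation_eq_zero hst₂ hD₂
    (fun a ha => hD₁E a (hAE (Or.inl (Or.inr ha)))) (fun a ha => hD₂A a (Or.inl (Or.inr ha))) hv hv0
  let p' : Fin (n + 1) → ℂ := fun i => D₁ (p i)
  set D₃ := β • D₁ + γ • D₂ with hD₃def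
  have hvec : D₃ (c * a) • p + (c * a * β) • p' + D₃ (c * b) • q + (c * b * γ) • q' = 0 := by
    ext i
    have h := hD₃ i
    have hp3 : D₃ (p i) = β * p' i := by simp [hD₃def, hD₂p, p']
    have hq3 : D₃ (q i) = γ * q' i := by simp [hD₃def, hD₂q, hD₁q]
    have h' : (c • (a • p + b • q)) i = (c * a) * p i + (c * b) * q i := by
      simp only [Pi.add_apply, Pi.smul_apply, smul_eq_mul]; ring
    rw [h', map_add, D₃.leibniz (c * a), D₃.leibniz (c * b), hp3, hq3] at h
    simp only [smul_eq_mul] at h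
    simp only [Pi.add_apply, Pi.smul_apply, smul_eq_mul, Pi.zero_apply]
    linear_combination h
  have happ : ∀ χ : Module.Dual ℂ (Fin (n + 1) → ℂ), (∀ v ∈ W, χ v = 0) →
      D₃ (c * a) * χ p + c * a * β * χ p' = 0 := by
    intro χ hχ
    have := congrArg χ hvec
    simpa [hχ q hqW, hχ q' hq'W] using this
  by_cases hβ : β = 0
  · have hDa : D₃ (c * a) = 0 := by
      have := happ φ hφW
      simpa [hβ, hφp] using this
    have htq' : t₁ q' = 0 := by
      rw [← Derivation.apply_dual (D := D) (fun a ha => hDk a (hAk (Or.inr (Or.inr ha)))), htq,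
        Derivation.map_one_eq_zero]
    have hsq' : s₁ q' = 1 := by
      rw [← Derivation.apply_dual (D := D) (fun a ha => hDk a (hAk (Or.inr (Or.inl ha)))), hDq]
    have hDb : D₃ (c * b) = 0 := by
      have := congrArg t₁ hvec
      simpa [hDa, hβ, htq', htq] using this
    have := congrArg s₁ hvec
    simp [hDa, hβ, hDb, hsq', hc, hb] at this
    exact hβγ.elim (fun h => h hβ) fun h => h this
  · have hφp' : φ p' = D₁ (φ p) :=
      (Derivation.apply_dual (fun a ha => hD₁E a (hφE ha)) p).symm
    have hψp' : ψ p' = D₁ (ψ p) :=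
      (Derivation.apply_dual (fun a ha => hD₁E a (hψE ha)) p).symm
    have hcaβ : c * a * β ≠ 0 := mul_ne_zero (mul_ne_zero hc ha) hβ
    have hwr : ψ p' * φ p = φ p' * ψ p := by
      refine mul_left_cancel₀ hcaβ ?_
      linear_combination φ p * happ ψ hψW - ψ p * happ φ hφW
    have he : ψ p / φ p * φ p = ψ p := div_mul_cancel₀ _ hφp
    have hDe : ∀ D' : Derivation ℤ ℂ ℂ, (∀ a ∈ E, D' a = 0) → D' (ψ p / φ p) = 0 := by
      intro D' hD'
      have hp' : (fun i => D' (p i)) = D' (s₁ p) • p' := by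
        ext i; exact hlin D' (fun a ha => hD' a (hAE ha)) i
      have h1 := Derivation.apply_dual (fun a ha => hD' a (hφE ha)) p
      have h2 := Derivation.apply_dual (fun a ha => hD' a (hψE ha)) p
      rw [hp', map_smul, smul_eq_mul] at h1 h2
      have h3 := congrArg D' he
      rw [D'.leibniz, h1, h2, smul_eq_mul, smul_eq_mul] at h3
      have h4 : φ p * φ p * D' (ψ p / φ p) = 0 := by
        linear_combination φ p * h3 + D' (s₁ p) * hwr - D' (s₁ p) * φ p' * he
      simpa [hφp] using h4
    have hea : IsAlgebraic E (ψ p / φ p) := by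
      by_contra h
      obtain ⟨D', hD', h1⟩ := E.exists_derivation_apply_eq_one h
      exact one_ne_zero (h1.symm.trans (hDe D' hD'))
    have hz := hΦ (ψ - (ψ p / φ p) • φ) (Set.mem_insert_of_mem _ ⟨_, hea, rfl⟩)
      (by simp [he])
    have hz₁ := hz _ (rep_mem_projCone hx₁)
    have he0 : ψ p / φ p = 0 := by
      have h : φ x₁.rep ≠ 0 := hφx _ rfl
      simpa [hψx₁, h] using hz₁
    have hz₂ := hz _ (rep_mem_projCone hx₂)
    rw [he0, zero_smul, sub_zero] at hz₂
    exact hψx _ rfl hz₂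

end

section projection
variable {n : ℕ}

lemma exists_projection (p : PS ℂ (n + 1)) :
    ∃ f : (Fin (n + 2) → ℂ) →ₗ[ℂ] (Fin (n + 1) → ℂ), LinearMap.ker f = p.submodule ∧
      Function.Surjective f := by
  have hfin : Module.finrank ℂ ((Fin (n + 2) → ℂ) ⧸ p.submodule) =
      Module.finrank ℂ (Fin (n + 1) → ℂ) := by
    have h := Submodule.finrank_quotient_add_finrank p.submodule
    rw [p.finrank_submodule, Module.finrank_fin_fun] at h
    rw [Module.finrank_fin_fun]
    exact Nat.add_right_cancel h
  refine ⟨(LinearEquiv.ofFinrankEq _ _ hfin).toLinearMap ∘ₗ p.submodule.mkQ, ?_, ?_⟩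
  · rw [LinearEquiv.ker_comp, Submodule.ker_mkQ]
  · exact (LinearEquiv.surjective _).comp p.submodule.mkQ_surjective

/-- A form invariant under translation along the kernel of a projection descends. -/
lemma exists_descended_form {k : ℕ} {f : (Fin (n + 2) → ℂ) →ₗ[ℂ] (Fin (n + 1) → ℂ)}
    (hf : Function.Surjective f) {G : MvPolynomial (Fin (n + 2)) ℂ} (hG : G.IsHomogeneous k)
    (hinv : ∀ v, ∀ w ∈ LinearMap.ker f, eval (v + w) G = eval v G) :
    ∃ H : MvPolynomial (Fin (n + 1)) ℂ, H.IsHomogeneous k ∧ ∀ v, eval (f v) H = eval v G := by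
  obtain ⟨g, hg⟩ := f.exists_rightInverse_of_surjective (LinearMap.range_eq_top.2 hf)
  let l : Fin (n + 2) → MvPolynomial (Fin (n + 1)) ℂ := fun i => linForm (LinearMap.proj i ∘ₗ g)
  have heval : ∀ w, eval w (aeval l G) = eval (g w) G := by
    intro w
    have : (aeval w).comp (aeval l) = (aeval (g w) : MvPolynomial (Fin (n + 2)) ℂ →ₐ[ℂ] ℂ) := by
      apply algHom_ext
      intro i
      rw [AlgHom.comp_apply, aeval_X, aeval_X]
      exact eval_linForm _ w
    exact congrArg (fun h => h G) this
  refine ⟨aeval l G, ?_, fun v => ?_⟩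
  · have := hG.aeval (fun i => l i) (n := 1) fun i => isHomogeneous_linForm _
    rwa [one_mul] at this
  · rw [heval, ← hinv v (g (f v) - v), add_sub_cancel]
    rw [LinearMap.mem_ker, map_sub, sub_eq_zero]
    exact congrArg (fun h : _ →ₗ[ℂ] _ => h (f v)) hg

/-- If the projections from `p` coincide, every line joining `p` to another point of the first
curve meets the second curve. -/
lemma exists_mem_line_of_zclosure_eq {δ₁ δ₂ : Set (PS ℂ (n + 1))} {e₂ : ℕ}
    (h₂ : IsIrredCurve δ₂ e₂) {p x : PS ℂ (n + 1)} (hx : x ∈ δ₁) (hxp : x ≠ p)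
    (hp : ∀ f : (Fin (n + 2) → ℂ) →ₗ[ℂ] (Fin (n + 1) → ℂ), LinearMap.ker f = p.submodule →
      zclosure (projImage f (δ₁ \ {p})) = zclosure (projImage f (δ₂ \ {p}))) :
    ∃ v ∈ projCone δ₂, v ∈ Submodule.span ℂ {p.rep, x.rep} ∧ v ≠ 0 := by
  by_contra! hline
  have hspan : ∀ v, v ∈ Submodule.span ℂ {p.rep} ↔ v ∈ p.submodule := fun v => by
    rw [Submodule.mem_span_singleton, mem_submodule_iff]
  have hxp' : x.rep ∉ p.submodule := fun h =>
    hxp (eq_of_mem_submodule x.rep_nonzero (rep_mem_submodule x) h)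
  obtain ⟨k, -, G, hG, hG₂, hinv, -, hGx⟩ := exists_cone_form h₂ (a := p.rep) (b := x.rep)
    (fun h => hxp' ((hspan _).1 h)) hline
  obtain ⟨f, hker, hf⟩ := exists_projection p
  obtain ⟨H, hH, hHG⟩ := exists_descended_form hf hG (by
    intro v w hw
    rw [hker] at hw
    obtain ⟨c, rfl⟩ := mem_submodule_iff.1 hw
    exact hinv c v)
  have hmk : ∀ (z : PS ℂ (n + 1)) (hz : f z.rep ≠ 0),
      f z.rep ∈ (Projectivization.mk ℂ (f z.rep) hz).submodule := fun z hz => by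
    rw [Projectivization.submodule_mk]
    exact Submodule.mem_span_singleton_self _
  have hfx : f x.rep ≠ 0 := fun h => hxp' (hker ▸ LinearMap.mem_ker.2 h)
  have hmem : Projectivization.mk ℂ (f x.rep) hfx ∈ zclosure (projImage f (δ₂ \ {p})) := by
    rw [← hp f hker]
    exact fun V hV => hV.2 ⟨x, ⟨hx, hxp⟩, hfx, rfl⟩
  have hz := hmem (projZeroLocus {H}) ⟨⟨{H}, by rintro _ rfl; exact ⟨k, hH⟩, rfl⟩, by
    rintro _ ⟨z, ⟨hz, -⟩, hfz, rfl⟩ _ rfl v hv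
    refine eval_eq_zero_of_mem_submodule hH hfz (hmk z hfz) ?_ hv
    rw [hHG]
    exact hG₂ _ (rep_mem_projCone hz)⟩
  refine hGx ?_
  rw [← hHG]
  exact hz H rfl _ (hmk x hfx)

lemma finite_and_ncard_coincident_projections_le {δ₁ δ₂ : Set (PS ℂ (n + 1))} {e₁ e₂ : ℕ} (hn : 2 ≤ n)
    (h₁ : IsIrredCurve δ₁ e₁) (h₂ : IsIrredCurve δ₂ e₂) (hnp : NonPlanar δ₁) (hne : δ₁ ≠ δ₂) :
    {p ∈ δ₁ | ∀ f : (Fin (n + 2) → ℂ) →ₗ[ℂ] (Fin (n + 1) → ℂ), LinearMap.ker f = p.submodule →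
      zclosure (projImage f (δ₁ \ {p})) = zclosure (projImage f (δ₂ \ {p}))}.Finite ∧
    {p ∈ δ₁ | ∀ f : (Fin (n + 2) → ℂ) →ₗ[ℂ] (Fin (n + 1) → ℂ), LinearMap.ker f = p.submodule →
      zclosure (projImage f (δ₁ \ {p})) = zclosure (projImage f (δ₂ \ {p}))}.ncard ≤ e₁ * e₂ := by
  obtain ⟨x, hx, y, hy, hxy, hline⟩ := exists_secant_disjoint (by omega) h₁ h₂ hnp hne
  obtain ⟨k, hk, G, hG, hG₂, hinv, hGx, hGy⟩ := exists_cone_form h₂ (a := x.rep) (b := y.rep)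
    (fun h => hxy (eq_of_mem_submodule y.rep_nonzero (by
      rwa [mem_submodule_iff, ← Submodule.mem_span_singleton]) (rep_mem_submodule y))) hline
  obtain ⟨hfin, hcard⟩ := finite_zeros h₁ hG ⟨y, hy, hGy⟩
  have hsub : {p ∈ δ₁ | ∀ f : (Fin (n + 2) → ℂ) →ₗ[ℂ] (Fin (n + 1) → ℂ),
      LinearMap.ker f = p.submodule →
      zclosure (projImage f (δ₁ \ {p})) = zclosure (projImage f (δ₂ \ {p}))} ⊆
      {x ∈ δ₁ | eval x.rep G = 0} := by
    rintro p ⟨hp₁, hp⟩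
    refine ⟨hp₁, ?_⟩
    by_cases hxp : x = p
    · exact hxp ▸ hGx
    obtain ⟨v, hv, hvs, hv0⟩ := exists_mem_line_of_zclosure_eq h₂ hx hxp hp
    obtain ⟨β, α, rfl⟩ := Submodule.mem_span_pair.1 hvs
    have hβ : β ≠ 0 := by
      rintro rfl
      rw [zero_smul, zero_add] at hv hv0
      exact hv0 (hline _ hv (Submodule.smul_mem _ _ (Submodule.subset_span (by simp))))
    have hz := hG₂ _ hv
    rw [hinv] at hz
    refine eval_eq_zero_of_mem_submodule hG (smul_ne_zero hβ p.rep_nonzero)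
      (p.submodule.smul_mem β (rep_mem_submodule p)) hz (rep_mem_submodule p)
  refine ⟨hfin.subset hsub, (Set.ncard_le_ncard hsub hfin).trans (hcard.trans ?_)⟩
  rw [mul_comm]
  exact Nat.mul_le_mul_left _ hk

end projection

end auxiliary

/-- Lemma 2.4.
Let `δ₁` and `δ₂` be two (distinct) irreducible non-planar curves in `ℂPᵈ`, `d ≥ 3` (below
`d = n + 1` with `n ≥ 2`), of degrees `e₁` and `e₂` respectively. Then there are at most
`O(e₁e₂)` points `p` on `δ₁` such that the Zariski closures of `π_p(δ₁ ∖ {p})` and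
`π_p(δ₂ ∖ {p})` coincide. -/
theorem projections_of_two_curves_coincide :
    ∃ C : ℝ, 0 < C ∧ ∀ n : ℕ, 2 ≤ n → ∀ e₁ e₂ : ℕ, ∀ δ₁ δ₂ : Set (PS ℂ (n + 1)),
      IsIrredAlg δ₁ → NonPlanar δ₁ → IsCurveDeg δ₁ e₁ →
      IsIrredAlg δ₂ → NonPlanar δ₂ → IsCurveDeg δ₂ e₂ → δ₁ ≠ δ₂ →
      ({p ∈ δ₁ | ∀ f : (Fin (n + 2) → ℂ) →ₗ[ℂ] (Fin (n + 1) → ℂ),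
          LinearMap.ker f = p.submodule →
            zclosure (projImage f (δ₁ \ {p})) = zclosure (projImage f (δ₂ \ {p}))}).Finite ∧
      (({p ∈ δ₁ | ∀ f : (Fin (n + 2) → ℂ) →ₗ[ℂ] (Fin (n + 1) → ℂ),
          LinearMap.ker f = p.submodule →
            zclosure (projImage f (δ₁ \ {p})) = zclosure (projImage f (δ₂ \ {p}))}).ncard : ℝ) ≤
        C * (e₁ : ℝ) * (e₂ : ℝ) := by
  refine ⟨1, one_pos, fun n hn e₁ e₂ δ₁ δ₂ hi₁ hnp hd₁ hi₂ _ hd₂ hne => ?_⟩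
  obtain ⟨hfin, hcard⟩ :=
    finite_and_ncard_coincident_projections_le hn (hd₁.isIrredCurve hi₁) (hd₂.isIrredCurve hi₂) hnp hne
  refine ⟨hfin, ?_⟩
  rw [one_mul]
  exact_mod_cast hcard
end
end

section
/- Let δ_p be an irreducible non-degenerate rational curve of degree d+1 in ℂP^d, d ≥ 2, where p ∈ ℂP^{d+1}∖ν_{d+1}. A hyperplane intersects δ_p in the d+1 points δ_p[x_i, y_i], i = 0, …, d, counting multiplicity, if and only if F_p(x_0, y_0, x_1, y_1, …, x_d, y_d) = 0. -/
open Classical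
noncomputable section

/-- The standard parametrisation of the rational normal curve `ν_{d+1}` in `ℂP^{d+1}`:
`[x, y] ↦ [y^{d+1}, -x y^d, x² y^{d-1}, …, (-x)^d y, (-x)^{d+1}]`. -/
def nuVec (d : ℕ) (x y : ℂ) : Fin (d + 2) → ℂ :=
  fun i => (-x) ^ (i : ℕ) * y ^ (d + 1 - (i : ℕ))

/-- The partial derivative of `nuVec` with respect to `x`. -/
def nuDx (d : ℕ) (x y : ℂ) : Fin (d + 2) → ℂ :=
  fun i => -(((i : ℕ) : ℂ)) * (-x) ^ ((i : ℕ) - 1) * y ^ (d + 1 - (i : ℕ))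

/-- The partial derivative of `nuVec` with respect to `y`. -/
def nuDy (d : ℕ) (x y : ℂ) : Fin (d + 2) → ℂ :=
  fun i => ((d + 1 - (i : ℕ) : ℕ) : ℂ) * (-x) ^ (i : ℕ) * y ^ (d - (i : ℕ))

/-- `q` lies on the affine cone over the rational normal curve `ν_{d+1}`. -/
def InNuCone (d : ℕ) (q : Fin (d + 2) → ℂ) : Prop :=
  ∃ x y c : ℂ, ¬(x = 0 ∧ y = 0) ∧ q = c • nuVec d x y

/-- `q` lies on the affine cone over the tangent variety `Tan_ℂ(ν_{d+1})`. -/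
def InTanCone (d : ℕ) (q : Fin (d + 2) → ℂ) : Prop :=
  ∃ x y : ℂ, ¬(x = 0 ∧ y = 0) ∧ q ∈ Submodule.span ℂ {nuDx d x y, nuDy d x y}

/-- `q` lies on the affine cone over the secant variety `Sec_ℂ(ν_{d+1})`: it lies on a line
through two distinct points of `ν_{d+1}`, or on a tangent line of `ν_{d+1}`. -/
def InSecCone (d : ℕ) (q : Fin (d + 2) → ℂ) : Prop :=
  (∃ x₁ y₁ x₂ y₂ : ℂ, ¬(x₁ = 0 ∧ y₁ = 0) ∧ ¬(x₂ = 0 ∧ y₂ = 0) ∧ x₁ * y₂ - x₂ * y₁ ≠ 0 ∧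
      q ∈ Submodule.span ℂ {nuVec d x₁ y₁, nuVec d x₂ y₂}) ∨ InTanCone d q

/-- `q` lies on the affine cone over the real secant variety `Sec_ℝ(ν_{d+1})`: `q` is real and
lies on a line through two distinct real points of `ν_{d+1}` or on a real tangent line. -/
def InSecRCone (d : ℕ) (q : Fin (d + 2) → ℂ) : Prop :=
  (∀ i, (q i).im = 0) ∧
  ((∃ x₁ y₁ x₂ y₂ : ℝ, ¬(x₁ = 0 ∧ y₁ = 0) ∧ ¬(x₂ = 0 ∧ y₂ = 0) ∧ x₁ * y₂ - x₂ * y₁ ≠ 0 ∧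
      q ∈ Submodule.span ℂ {nuVec d x₁ y₁, nuVec d x₂ y₂}) ∨
    (∃ x y : ℝ, ¬(x = 0 ∧ y = 0) ∧ q ∈ Submodule.span ℂ {nuDx d x y, nuDy d x y}))

/-- The fundamental binary form `f_p(x,y) = ∑ p_i (d+1 choose i) x^{d+1-i} y^i`. -/
def fForm (d : ℕ) (p : Fin (d + 2) → ℂ) (x y : ℂ) : ℂ :=
  ∑ i : Fin (d + 2), p i * ((d + 1).choose (i : ℕ) : ℂ) * x ^ (d + 1 - (i : ℕ)) * y ^ (i : ℕ)

/-- The polarisation `F_p = ∑ p_i P_i` of the fundamental binary form, where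
`P_i = ∑_{|I| = i} ∏_{j ∉ I} x_j ∏_{j ∈ I} y_j`. -/
def Fpol (d : ℕ) (p : Fin (d + 2) → ℂ) (X Y : Fin (d + 1) → ℂ) : ℂ :=
  ∑ I : Finset (Fin (d + 1)),
    p ⟨I.card, by
        have h : I.card ≤ d + 1 := by simpa using I.card_le_univ
        omega⟩ *
      ((∏ j ∈ Iᶜ, X j) * ∏ j ∈ I, Y j)

/-- The `(k+1) × (d-k+2)` Hankel matrix `M_k(p)` with entries `p_{i+j}`. -/
def hankel (d k : ℕ) (hk : k ≤ d) (p : Fin (d + 2) → ℂ) :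
    Matrix (Fin (k + 1)) (Fin (d - k + 2)) ℂ :=
  fun i j => p ⟨(i : ℕ) + (j : ℕ), by have hi := i.isLt; have hj := j.isLt; omega⟩

/-- The polarisation as a linear functional of the point `p`. -/
def FpolLin (d : ℕ) (X Y : Fin (d + 1) → ℂ) : (Fin (d + 2) → ℂ) →ₗ[ℂ] ℂ where
  toFun p := Fpol d p X Y
  map_add' p q := by simp [Fpol, add_mul, Finset.sum_add_distrib]
  map_smul' c p := by simp [Fpol, Finset.mul_sum, mul_assoc]

/-- On the rational normal curve the polarisation is, up to sign, the product of the linear forms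
`Yᵢ x - Xᵢ y`. -/
lemma Fpol_nuVec (d : ℕ) (X Y : Fin (d + 1) → ℂ) (x y : ℂ) :
    Fpol d (nuVec d x y) X Y = (-1) ^ (d + 1) * ∏ i : Fin (d + 1), (Y i * x - X i * y) := by
  have h : (-1 : ℂ) ^ (d + 1) * ∏ i : Fin (d + 1), (Y i * x - X i * y) =
      ∏ i : Fin (d + 1), (Y i * (-x) + X i * y) := by
    have hc : (-1 : ℂ) ^ (d + 1) = ∏ _i : Fin (d + 1), (-1 : ℂ) := by simp
    rw [hc, ← Finset.prod_mul_distrib]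
    exact Finset.prod_congr rfl fun i _ => by ring
  rw [h, Finset.prod_add, Finset.powerset_univ]
  refine Finset.sum_congr rfl fun I _ => ?_
  rw [← Finset.compl_eq_univ_sdiff, Finset.prod_mul_distrib, Finset.prod_mul_distrib,
    Finset.prod_const, Finset.prod_const, Finset.card_compl, Fintype.card_fin]
  simp only [nuVec]
  ring

/-- The rational normal curve is non-degenerate: linear functionals are determined by their values
on it. -/
lemma linearMap_ext_nuVec (d : ℕ) {L M : (Fin (d + 2) → ℂ) →ₗ[ℂ] ℂ}
    (h : ∀ x y : ℂ, L (nuVec d x y) = M (nuVec d x y)) : L = M := by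
  let P (N : (Fin (d + 2) → ℂ) →ₗ[ℂ] ℂ) : Polynomial ℂ :=
    ∑ i : Fin (d + 2), Polynomial.C (N (Pi.single i 1)) * Polynomial.X ^ (i : ℕ)
  have heval (N : (Fin (d + 2) → ℂ) →ₗ[ℂ] ℂ) (t : ℂ) :
      (P N).eval t = N (nuVec d (-t) 1) := by
    rw [LinearMap.pi_apply_eq_sum_univ N (nuVec d (-t) 1)]
    simp only [P, Polynomial.eval_finsetSum, Polynomial.eval_mul, Polynomial.eval_C,
      Polynomial.eval_pow, Polynomial.eval_X, nuVec, neg_neg, one_pow, mul_one, smul_eq_mul]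
    refine Finset.sum_congr rfl fun i _ => ?_
    rw [mul_comm]
    congr 2
    ext j
    simp [Pi.single_apply, eq_comm]
  have hcoeff (N : (Fin (d + 2) → ℂ) →ₗ[ℂ] ℂ) (i : Fin (d + 2)) :
      (P N).coeff i = N (Pi.single i 1) := by
    simp [P, Polynomial.finsetSum_coeff, Polynomial.coeff_X_pow, ← Fin.ext_iff]
  have hP : P L = P M := Polynomial.funext fun t => by rw [heval, heval, h]
  refine LinearMap.pi_ext' fun i => LinearMap.ext_ring ?_
  simpa [hcoeff] using congrArg (fun Q => Polynomial.coeff Q (i : ℕ)) hP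

/-- A product of nonzero binary linear forms is not identically zero. -/
lemma exists_prod_linear_forms_ne_zero {ι : Type*} [Fintype ι] (X Y : ι → ℂ)
    (hXY : ∀ i, ¬(X i = 0 ∧ Y i = 0)) :
    ∃ x y : ℂ, ∏ i, (Y i * x - X i * y) ≠ 0 := by
  by_contra! h
  have hP : ∏ i, (Polynomial.C (Y i) - Polynomial.C (X i) * Polynomial.X) = 0 :=
    Polynomial.funext fun t => by simpa [Polynomial.eval_prod] using h 1 t
  obtain ⟨i, -, hi⟩ := Finset.prod_eq_zero_iff.mp hP
  refine hXY i ⟨?_, ?_⟩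
  · simpa using congrArg (fun Q => Polynomial.coeff Q 1) hi
  · simpa using congrArg (fun Q => Polynomial.coeff Q 0) hi

/-- Lemma 3.5.
Let `δ_p` be the irreducible non-degenerate rational curve of degree `d + 1` in `ℂPᵈ`,
`d ≥ 2`, obtained by projecting the rational normal curve `ν_{d+1} ⊂ ℂP^{d+1}` from a point
`p ∉ ν_{d+1}` via a linear map `A` with kernel spanned by `p`. A hyperplane (given by a
nonzero linear functional `lam`) intersects `δ_p` in the `d + 1` points `δ_p[Xᵢ, Yᵢ]`,
`i = 0, …, d`, counting multiplicity (i.e., the binary form `lam ∘ A ∘ ν_{d+1}` is a nonzero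
scalar multiple of `∏ᵢ (Yᵢ·x - Xᵢ·y)`), if and only if `F_p(X₀, Y₀, …, X_d, Y_d) = 0`. -/
theorem hyperplane_section_iff_polarisation_vanishes
    (d : ℕ) (hd : 2 ≤ d) (p : Fin (d + 2) → ℂ) (hp : p ≠ 0)
    (hpnu : ∀ x y : ℂ, ¬(x = 0 ∧ y = 0) → ¬∃ c : ℂ, p = c • nuVec d x y)
    (A : (Fin (d + 2) → ℂ) →ₗ[ℂ] (Fin (d + 1) → ℂ))
    (hA : LinearMap.ker A = Submodule.span ℂ {p})
    (X Y : Fin (d + 1) → ℂ) (hXY : ∀ i, ¬(X i = 0 ∧ Y i = 0)) :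
    (∃ lam : (Fin (d + 1) → ℂ) →ₗ[ℂ] ℂ, lam ≠ 0 ∧ ∃ c : ℂ, c ≠ 0 ∧
        ∀ x y : ℂ, lam (A (nuVec d x y)) = c * ∏ i : Fin (d + 1), (Y i * x - X i * y)) ↔
      Fpol d p X Y = 0 := by
  have hsign : (-1 : ℂ) ^ (d + 1) ≠ 0 := pow_ne_zero _ (by norm_num)
  constructor
  · rintro ⟨lam, -, c, hc, h⟩
    have hL : ((-1) ^ (d + 1) : ℂ) • lam ∘ₗ A = c • FpolLin d X Y :=
      linearMap_ext_nuVec d fun x y => by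
        change (-1) ^ (d + 1) * lam (A (nuVec d x y)) = c * Fpol d (nuVec d x y) X Y
        rw [h, Fpol_nuVec]
        ring
    have hAp : A p = 0 := by
      rw [← LinearMap.mem_ker, hA]
      exact Submodule.mem_span_singleton_self p
    have hLp := LinearMap.congr_fun hL p
    change (-1) ^ (d + 1) * lam (A p) = c * Fpol d p X Y at hLp
    rw [hAp, map_zero, mul_zero] at hLp
    exact (mul_eq_zero.mp hLp.symm).resolve_left hc
  · intro hF
    have hmem : FpolLin d X Y ∈ LinearMap.range A.dualMap := by
      rw [LinearMap.range_dualMap_eq_dualAnnihilator_ker, hA, Submodule.mem_dualAnnihilator]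
      intro w hw
      obtain ⟨a, rfl⟩ := Submodule.mem_span_singleton.mp hw
      rw [map_smul, show FpolLin d X Y p = 0 from hF, smul_zero]
    obtain ⟨lam, hlam⟩ := hmem
    have hval (x y : ℂ) : lam (A (nuVec d x y)) =
        (-1) ^ (d + 1) * ∏ i : Fin (d + 1), (Y i * x - X i * y) := by
      rw [← Fpol_nuVec]
      exact LinearMap.congr_fun hlam _
    refine ⟨lam, ?_, _, hsign, hval⟩
    rintro rfl
    obtain ⟨x, y, hxy⟩ := exists_prod_linear_forms_ne_zero X Y hXY
    exact mul_ne_zero hsign hxy (hval x y).symm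
end
end
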